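/- arXiv:2208.13367 — 4 statements merged into one kernel-verified Lean document; each statement's English description precedes it below -/
import Mathlib

section
/- With notation as in the context, there exists a real analytic function Z on (0,1] (meaning Z extends real analytically to an open interval containing (0,1]) satisfying r·Z'(r)·P̂(Z(r)) + Q̂(Z(r)) = 0 for all r ∈ (0,1] and Z(1) = 0, and moreover Z'(r) < 0 for all r ∈ (0,1]; and such a solution is unique: any two real analytic functions on (0,1] satisfying this ODE with value 0 at r = 1 coincide on (0,1]. -/
open Polynomial Set

open Filter Topology ContDiff in
theorem aux_prim (F G : ℝ → ℝ) (x0 : ℝ) (hG : AnalyticAt ℝ G x0)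
    (hF : ∀ᶠ x in 𝓝 x0, HasDerivAt F (G x) x) : AnalyticAt ℝ F x0 := by
  obtain ⟨p, r, hp⟩ := hG
  let c : ℕ → ℝ := fun n => p.coeff (n - 1) / n
  let q := FormalMultilinearSeries.ofScalars ℝ c
  have hcoeff : ∀ n, q.coeff n = c n := fun n => FormalMultilinearSeries.coeff_ofScalars
  obtain ⟨r', hr'0, hr'⟩ := ENNReal.lt_iff_exists_nnreal_btwn.1 (hp.r_pos)
  have hr'1 : (0:ℝ) < r' := by exact_mod_cast hr'0
  obtain ⟨K, hK0, hK⟩ := p.norm_mul_pow_le_of_lt_radius (lt_of_lt_of_le hr' hp.r_le)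
  have hrad : (r' : ENNReal) ≤ q.radius := by
    refine q.le_radius_of_bound (K * r') (fun n => ?_)
    rw [FormalMultilinearSeries.norm_apply_eq_norm_coef, hcoeff]
    rcases n with _ | n
    · simp [c]; positivity
    · have h1 := hK n
      rw [FormalMultilinearSeries.norm_apply_eq_norm_coef] at h1
      simp only [c, Nat.add_sub_cancel]
      rw [norm_div, pow_succ, ← mul_assoc]
      refine mul_le_mul_of_nonneg_right (le_trans ?_ h1) hr'1.le
      refine mul_le_mul_of_nonneg_right (div_le_self (norm_nonneg _) ?_) (by positivity)
      simp
      rw [abs_of_nonneg (by positivity)]; linarith [(Nat.cast_nonneg n : (0:ℝ) ≤ n)]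
  have hqpos : 0 < q.radius := lt_of_lt_of_le hr'0 hrad
  have hq := q.hasFPowerSeriesOnBall hqpos
  have hqd := hq.fderiv
  have hder : ∀ y : ℝ, ‖y‖ < r' → HasDerivAt q.sum (G (x0 + y)) y := by
    intro y hy
    have hy' : y ∈ Metric.eball (0:ℝ) r' := by
      rw [Metric.mem_eball, edist_zero_right]
      rw [enorm_eq_nnnorm]
      exact_mod_cast hy
    have hyq : y ∈ Metric.eball (0:ℝ) q.radius := Metric.eball_subset_eball hrad hy'
    have hyp : y ∈ Metric.eball (0:ℝ) r := Metric.eball_subset_eball hr'.le hy'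
    have s1 := hp.hasSum hyp
    have s2 := (hqd.hasSum hyq).mapL (ContinuousLinearMap.apply ℝ ℝ (1:ℝ))
    have hd : DifferentiableAt ℝ q.sum y := by
      have := hq.analyticAt_of_mem (y := y) (by simpa using hyq)
      exact this.differentiableAt
    have : G (x0 + y) = deriv q.sum y := by
      refine s1.unique ?_
      simp only [zero_add] at s2
      have e : deriv q.sum y = (ContinuousLinearMap.apply ℝ ℝ (1:ℝ)) (fderiv ℝ q.sum y) := by
        simp
      rw [e]
      convert! s2 using 2 with n
      rw [FormalMultilinearSeries.apply_eq_pow_smul_coeff, FormalMultilinearSeries.apply_eq_pow_smul_coeff]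
      simp only [map_smul, ContinuousLinearMap.apply_apply]
      rw [FormalMultilinearSeries.derivSeries_coeff_one, hcoeff]
      simp [c]
      left
      field_simp
    rw [this]; exact hd.hasDerivAt
  obtain ⟨ε, hε, hball⟩ := Metric.eventually_nhds_iff_ball.1 hF
  set δ := min ε r' with hδ
  have hδ0 : 0 < δ := lt_min hε hr'1
  have hA : AnalyticAt ℝ (fun x => q.sum (x - x0)) x0 := by
    have h0 : AnalyticAt ℝ q.sum (x0 - x0) := by simpa using hq.analyticAt
    exact h0.comp (f := fun x => x - x0) (by fun_prop)
  have hconst : ∀ x ∈ Metric.ball x0 δ, F x - q.sum (x - x0) = F x0 - q.sum (x0 - x0) := by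
    intro x hx
    have hdd : ∀ z ∈ Metric.ball x0 δ, HasDerivAt (fun x => F x - q.sum (x - x0)) 0 z := by
      intro z hz
      have h1 := hball z (Metric.ball_subset_ball (min_le_left _ _) hz)
      have h2 := hder (z - x0) (by
        have := Metric.ball_subset_ball (min_le_right ε (r':ℝ)) hz
        rwa [mem_ball_iff_norm] at this)
      have h3 := h1.sub (h2.comp z ((hasDerivAt_id z).sub_const x0))
      simpa using! h3
    refine (convex_ball x0 δ).is_const_of_fderivWithin_eq_zero (𝕜 := ℝ) (f := fun x => F x - q.sum (x - x0)) ?_ ?_ hx (Metric.mem_ball_self hδ0)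
    · intro z hz; exact (hdd z hz).differentiableAt.differentiableWithinAt
    · intro z hz
      rw [fderivWithin_of_isOpen Metric.isOpen_ball hz]
      ext; simp [(hdd z hz).deriv]
  refine (hA.add (analyticAt_const (v := F x0 - q.sum (x0 - x0)))).congr ?_
  filter_upwards [Metric.ball_mem_nhds x0 hδ0] with x hx
  have := hconst x hx
  simp only [Pi.add_apply]
  linarith

open Filter Topology ContDiff in
theorem aux_inv (T g : ℝ → ℝ) (U : Set ℝ) (hU : IsOpen U) (x : ℝ) (hx : x ∈ U)
    (hT : AnalyticAt ℝ T x) (hd : deriv T x ≠ 0)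
    (hg : ∀ y ∈ U, g (T y) = y) : AnalyticAt ℝ g (T x) := by
  have hs : HasStrictDerivAt T (deriv T x) x := hT.hasStrictDerivAt
  have hs' := hs.hasStrictFDerivAt_equiv hd
  have hc : ContDiffAt ℝ ω T x := hT.contDiffAt
  have hl := (hc.to_localInverse hs'.hasFDerivAt (by simp)).analyticAt
  refine hl.congr ?_
  have e1 := (hc.hasStrictFDerivAt' hs'.hasFDerivAt (by simp)).eventually_right_inverse
  have e2 := hl.continuousAt.eventually (p := fun z => z ∈ U) (by
    rw [ContDiffAt.localInverse_apply_image]; exact hU.mem_nhds hx)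
  filter_upwards [e1, e2] with s h1 h2
  have := hg _ h2
  rw [← this]
  congr 1

open Filter Topology ContDiff in
theorem aux_main (p q : Polynomial ℝ) (B : ℝ) (hB : 0 < B)
    (hp : ∀ x ∈ Icc 0 B, 0 < p.eval x) (hq : ∀ x ∈ Ico 0 B, 0 < q.eval x)
    (hqB : q.eval B = 0) :
    (∃ Z : ℝ → ℝ,
      (∃ c d : ℝ, Ioc (0 : ℝ) 1 ⊆ Ioo c d ∧ AnalyticOnNhd ℝ Z (Ioo c d)) ∧
      (∀ r ∈ Ioc (0 : ℝ) 1,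
        r * deriv Z r * p.eval (Z r) + q.eval (Z r) = 0) ∧
      Z 1 = 0 ∧
      (∀ r ∈ Ioc (0 : ℝ) 1, deriv Z r < 0)) ∧
    (∀ Z₁ Z₂ : ℝ → ℝ,
      (∃ c d : ℝ, Ioc (0 : ℝ) 1 ⊆ Ioo c d ∧ AnalyticOnNhd ℝ Z₁ (Ioo c d)) →
      (∀ r ∈ Ioc (0 : ℝ) 1,
        r * deriv Z₁ r * p.eval (Z₁ r) + q.eval (Z₁ r) = 0) →
      Z₁ 1 = 0 →
      (∃ c d : ℝ, Ioc (0 : ℝ) 1 ⊆ Ioo c d ∧ AnalyticOnNhd ℝ Z₂ (Ioo c d)) →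
      (∀ r ∈ Ioc (0 : ℝ) 1,
        r * deriv Z₂ r * p.eval (Z₂ r) + q.eval (Z₂ r) = 0) →
      Z₂ 1 = 0 →
      EqOn Z₁ Z₂ (Ioc (0 : ℝ) 1)) := by
  -- extend positivity slightly to the left of zero
  have hev : ∀ᶠ x in 𝓝 (0:ℝ), 0 < p.eval x ∧ 0 < q.eval x :=
    ((p.continuous.continuousAt (x := 0)).eventually (lt_mem_nhds (hp 0 ⟨le_rfl, hB.le⟩))).and
      ((q.continuous.continuousAt (x := 0)).eventually (lt_mem_nhds (hq 0 ⟨le_rfl, hB⟩)))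
  obtain ⟨ε, hε, hball⟩ := Metric.eventually_nhds_iff_ball.1 hev
  set U := Ioo (-ε) B with hUdef
  have hUo : IsOpen U := isOpen_Ioo
  have h0U : (0:ℝ) ∈ U := ⟨by linarith, hB⟩
  have hpU : ∀ x ∈ U, 0 < p.eval x := by
    intro x hx
    rcases lt_or_ge x 0 with h | h
    · exact (hball x (by rw [mem_ball_zero_iff, Real.norm_eq_abs, abs_lt]; constructor <;> linarith [hx.1])).1
    · exact hp x ⟨h, hx.2.le⟩
  have hqU : ∀ x ∈ U, 0 < q.eval x := by
    intro x hx
    rcases lt_or_ge x 0 with h | h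
    · exact (hball x (by rw [mem_ball_zero_iff, Real.norm_eq_abs, abs_lt]; constructor <;> linarith [hx.1])).2
    · exact hq x ⟨h, hx.2⟩
  set G : ℝ → ℝ := fun x => p.eval x / q.eval x with hG
  have hGpos : ∀ x ∈ U, 0 < G x := fun x hx => div_pos (hpU x hx) (hqU x hx)
  have hpa : ∀ (s : Polynomial ℝ) (x : ℝ), AnalyticAt ℝ (fun x => s.eval x) x := by
    intro s x
    have := AnalyticAt.aeval_polynomial (analyticAt_id (𝕜 := ℝ) (z := x)) s
    simpa using! this
  have hGa : ∀ x ∈ U, AnalyticAt ℝ G x := fun x hx => (hpa p x).div (hpa q x) (hqU x hx).ne'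
  have hGc : ContinuousOn G U := fun x hx => (hGa x hx).continuousAt.continuousWithinAt
  set T : ℝ → ℝ := fun x => ∫ t in (0:ℝ)..x, G t with hTdef
  have hTd : ∀ x ∈ U, HasDerivAt T (G x) x := by
    intro x hx
    refine intervalIntegral.integral_hasDerivAt_right ?_ ?_ (hGa x hx).continuousAt
    · apply ContinuousOn.intervalIntegrable
      exact hGc.mono (OrdConnected.uIcc_subset ordConnected_Ioo h0U hx)
    · exact hGc.stronglyMeasurableAtFilter hUo x hx
  have hT0 : T 0 = 0 := by simp [hTdef]
  have hTa : ∀ x ∈ U, AnalyticAt ℝ T x := by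
    intro x hx
    refine aux_prim T G x (hGa x hx) ?_
    filter_upwards [hUo.mem_nhds hx] with y hy using hTd y hy
  have hTc : ContinuousOn T U := fun x hx => (hTd x hx).continuousAt.continuousWithinAt
  have hTm : StrictMonoOn T U := by
    refine strictMonoOn_of_deriv_pos (convex_Ioo _ _) hTc ?_
    intro x hx
    rw [hUo.interior_eq] at hx
    rw [(hTd x hx).deriv]; exact hGpos x hx
  -- divergence at the right end point
  have hTun : ∀ M : ℝ, ∃ x ∈ Ico 0 B, M < T x := by
    obtain ⟨s, hs⟩ := Polynomial.dvd_iff_isRoot.2 hqB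
    have hsq : ∀ x, q.eval x = (B - x) * (-s.eval x) := by intro x; rw [hs]; simp; ring
    obtain ⟨x1, hx1, hmin⟩ := isCompact_Icc.exists_isMinOn (nonempty_Icc.2 hB.le)
      (p.continuous.continuousOn (s := Icc 0 B))
    obtain ⟨L, hL⟩ := isCompact_Icc.exists_bound_of_continuousOn (s.continuous.continuousOn (s := Icc 0 B))
    have hc := hp x1 hx1
    set c := p.eval x1
    have hL0 : 0 ≤ L := le_trans (norm_nonneg _) (hL x1 hx1)
    set k := c / (L + 1) with hk
    have hk0 : 0 < k := by positivity
    have hmon : MonotoneOn (fun x => T x + k * Real.log (B - x)) (Ico 0 B) := by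
      have hder : ∀ x ∈ Ico 0 B, HasDerivAt (fun x => T x + k * Real.log (B - x))
          (G x + k * (-1 / (B - x))) x := by
        intro x hx
        have h1 : HasDerivAt (fun x => B - x) (-1) x := by
          simpa using (hasDerivAt_id x).const_sub B
        exact (hTd x ⟨by linarith [hx.1], hx.2⟩).add ((h1.log (by linarith [hx.2])).const_mul k)
      refine monotoneOn_of_deriv_nonneg (convex_Ico _ _) ?_ ?_ ?_
      · intro x hx; exact (hder x hx).continuousAt.continuousWithinAt
      · intro x hx; exact (hder x (interior_subset hx)).differentiableAt.differentiableWithinAt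
      · intro x hx
        have hx := interior_subset hx
        rw [(hder x hx).deriv]
        have hBx : 0 < B - x := by linarith [hx.2]
        have hq' := hq x hx
        have hxI : x ∈ Icc 0 B := ⟨hx.1, hx.2.le⟩
        have hs' : -s.eval x ≤ L + 1 := by
          have := hL x hxI
          rw [Real.norm_eq_abs] at this
          linarith [neg_abs_le (s.eval x)]
        have hpc : c ≤ p.eval x := hmin hxI
        have hgoal : k / (B - x) ≤ G x := by
          simp only [hG]
          rw [div_le_div_iff₀ hBx hq', hsq]
          have : k * (-s.eval x) ≤ c := by
            calc k * (-s.eval x) ≤ k * (L + 1) := by gcongr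
              _ = c := by rw [hk]; field_simp
          nlinarith
        have : k * (-1 / (B - x)) = - (k / (B - x)) := by ring
        rw [this]; linarith
    intro M
    set δ := min B (Real.exp (- (M + 1 - k * Real.log B) / k)) with hδ
    have hδ0 : 0 < δ := lt_min hB (Real.exp_pos _)
    refine ⟨B - δ, ⟨by linarith [min_le_left B (Real.exp (- (M + 1 - k * Real.log B) / k))], by linarith⟩, ?_⟩
    have := hmon (a := 0) (b := B - δ) ⟨le_rfl, hB⟩ ⟨by linarith [min_le_left B (Real.exp (- (M + 1 - k * Real.log B) / k))], by linarith⟩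
      (by linarith [min_le_left B (Real.exp (- (M + 1 - k * Real.log B) / k))])
    simp only [hT0, sub_zero, zero_add, sub_sub_cancel] at this
    have hlog : Real.log δ ≤ - (M + 1 - k * Real.log B) / k := by
      rw [Real.log_le_iff_le_exp hδ0]; exact min_le_right _ _
    rw [le_div_iff₀ hk0] at hlog
    linarith
  constructor
  · have ha' : (-ε/2) ∈ U := ⟨by linarith, by linarith⟩
    set d := Real.exp (- T (-ε/2)) with hd
    have hTneg : T (-ε/2) < 0 := by rw [← hT0]; exact hTm ha' h0U (by linarith)
    have hd1 : 1 < d := Real.one_lt_exp_iff.2 (by linarith)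
    set g := Function.invFunOn T U
    have hg : ∀ y ∈ U, g (T y) = y := fun y hy => hTm.injOn.leftInvOn_invFunOn hy
    have hsurj : ∀ r ∈ Ioo 0 d, ∃ x ∈ U, T x = - Real.log r := by
      intro r hr
      obtain ⟨x, hx, hM⟩ := hTun (-Real.log r)
      have h1 : T (-ε/2) ≤ - Real.log r := by
        have := Real.log_lt_log hr.1 hr.2
        rw [hd, Real.log_exp] at this
        linarith
      have hsub : Icc (-ε/2) x ⊆ U := fun y hy => ⟨by linarith [hy.1], lt_of_le_of_lt hy.2 hx.2⟩
      obtain ⟨y, hy, hyT⟩ := intermediate_value_Icc (by linarith [hx.1] : -ε/2 ≤ x) (hTc.mono hsub)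
        ⟨h1, hM.le⟩
      exact ⟨y, hsub hy, hyT⟩
    have hZa : ∀ r ∈ Ioo 0 d, AnalyticAt ℝ (fun r => g (-Real.log r)) r := by
      intro r hr
      obtain ⟨x, hx, hxT⟩ := hsurj r hr
      have h1 : AnalyticAt ℝ g (-Real.log r) := by
        rw [← hxT]
        exact aux_inv T g U hUo x hx (hTa x hx) (by rw [(hTd x hx).deriv]; exact (hGpos x hx).ne') hg
      have h2 : AnalyticAt ℝ (fun r => -Real.log r) r := (analyticAt_log hr.1).neg
      exact AnalyticAt.comp (g := g) (f := fun r => -Real.log r) h1 h2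
    have hZd : ∀ r ∈ Ioo 0 d, g (-Real.log r) ∈ U ∧
        G (g (-Real.log r)) * deriv (fun r => g (-Real.log r)) r = - r⁻¹ := by
      intro r hr
      obtain ⟨x, hx, hxT⟩ := hsurj r hr
      have hgx : g (-Real.log r) = x := by rw [← hxT, hg x hx]
      have hmem : g (-Real.log r) ∈ U := by rw [hgx]; exact hx
      refine ⟨hmem, ?_⟩
      have h1 := (hTd _ hmem).comp r (hZa r hr).differentiableAt.hasDerivAt
      have h2 : HasDerivAt (fun r => -Real.log r) (-r⁻¹) r := (Real.hasDerivAt_log hr.1.ne').neg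
      have h3 : (T ∘ fun r => g (-Real.log r)) =ᶠ[𝓝 r] fun r => - Real.log r := by
        filter_upwards [isOpen_Ioo.mem_nhds hr] with t ht
        obtain ⟨y, hy, hyT⟩ := hsurj t ht
        simp only [Function.comp]
        rw [← hyT, hg y hy]
      exact h1.unique (h2.congr_of_eventuallyEq h3)
    have hsub : Ioc (0:ℝ) 1 ⊆ Ioo 0 d := fun r hr => ⟨hr.1, lt_of_le_of_lt hr.2 hd1⟩
    refine ⟨fun r => g (-Real.log r), ⟨0, d, hsub, hZa⟩, ?_, ?_, ?_⟩
    · intro r hr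
      obtain ⟨hm, he⟩ := hZd r (hsub hr)
      have hq' := hqU _ hm
      have hr0 := hr.1
      simp only [hG] at he ⊢
      set D := deriv (fun r => g (-Real.log r)) r
      field_simp at he
      linarith
    · have := hg 0 h0U
      rw [hT0] at this
      simpa using this
    · intro r hr
      obtain ⟨hm, he⟩ := hZd r (hsub hr)
      have h1 := hGpos _ hm
      have h2 : 0 < r⁻¹ := inv_pos.2 hr.1
      by_contra hcon
      push Not at hcon
      have := mul_nonneg h1.le hcon
      linarith
  · have key : ∀ Z : ℝ → ℝ, 
        (∃ c d : ℝ, Ioc (0 : ℝ) 1 ⊆ Ioo c d ∧ AnalyticOnNhd ℝ Z (Ioo c d)) →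
        (∀ r ∈ Ioc (0 : ℝ) 1, r * deriv Z r * p.eval (Z r) + q.eval (Z r) = 0) →
        Z 1 = 0 → ∀ᶠ r in 𝓝[<] (1:ℝ), Z r ∈ U ∧ T (Z r) = - Real.log r := by
      rintro Z ⟨c, d, hcd, hZ⟩ hode hZ1
      have h1 : (1:ℝ) ∈ Ioc (0:ℝ) 1 := ⟨one_pos, le_rfl⟩
      have hcont := (hZ 1 (hcd h1)).continuousAt
      have hev : ∀ᶠ r in 𝓝 (1:ℝ), Z r ∈ U ∧ 0 < r :=
        (hcont.eventually (hUo.mem_nhds (by rw [hZ1]; exact h0U))).and (lt_mem_nhds one_pos)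
      obtain ⟨δ, hδ, hb⟩ := Metric.eventually_nhds_iff_ball.1 hev
      have hI : ∀ r ∈ Icc (1 - δ/2) 1, Z r ∈ U ∧ 0 < r := fun r hr => hb r (by
        rw [Metric.mem_ball, Real.dist_eq, abs_lt]; constructor <;> linarith [hr.1, hr.2])
      have hdz : ∀ r ∈ Icc (1 - δ/2) 1, HasDerivAt (fun r => T (Z r) + Real.log r) 0 r := by
        intro r hr
        obtain ⟨hm, hr0⟩ := hI r hr
        have hr' : r ∈ Ioc (0:ℝ) 1 := ⟨hr0, hr.2⟩
        have e1 := ((hTd _ hm).comp r (hZ r (hcd hr')).differentiableAt.hasDerivAt).add (Real.hasDerivAt_log hr0.ne')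
        have e2 : G (Z r) * deriv Z r + r⁻¹ = 0 := by
          have hq' := hqU _ hm
          have := hode r hr'
          simp only [hG]
          field_simp
          linarith
        rw [e2] at e1
        exact e1
      have hconst := constant_of_has_deriv_right_zero (f := fun r => T (Z r) + Real.log r)
        (a := 1 - δ/2) (b := 1) (fun r hr => (hdz r hr).continuousAt.continuousWithinAt)
        (fun r hr => (hdz r ⟨hr.1, hr.2.le⟩).hasDerivWithinAt)
      have hc1 := hconst 1 ⟨by linarith, le_rfl⟩
      filter_upwards [Ioo_mem_nhdsLT (show 1 - δ/2 < 1 by linarith)] with r hr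
      have hr' : r ∈ Icc (1 - δ/2) 1 := ⟨hr.1.le, hr.2.le⟩
      refine ⟨(hI r hr').1, ?_⟩
      have := hconst r hr'
      simp only [hZ1, hT0, Real.log_one] at hc1 this
      linarith
    intro Z₁ Z₂ hZ1 ho1 h11 hZ2 ho2 h21
    have k1 := key Z₁ hZ1 ho1 h11
    have k2 := key Z₂ hZ2 ho2 h21
    obtain ⟨c1, d1, hs1, ha1⟩ := hZ1
    obtain ⟨c2, d2, hs2, ha2⟩ := hZ2
    have hsub : Ioc (0:ℝ) 1 ⊆ Ioo c1 d1 ∩ Ioo c2 d2 := subset_inter hs1 hs2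
    have hpre : IsPreconnected (Ioo c1 d1 ∩ Ioo c2 d2) :=
      (ordConnected_Ioo.inter ordConnected_Ioo).isPreconnected
    refine EqOn.mono hsub (AnalyticOnNhd.eqOn_of_preconnected_of_frequently_eq
      (ha1.mono inter_subset_left) (ha2.mono inter_subset_right) hpre
      (hsub ⟨one_pos, le_rfl⟩) ?_)
    have : ∀ᶠ r in 𝓝[<] (1:ℝ), Z₁ r = Z₂ r := by
      filter_upwards [k1, k2] with r e1 e2
      exact hTm.injOn e1.1 e2.1 (e1.2.trans e2.2.symm)
    exact this.frequently.filter_mono (nhdsWithin_mono _ (fun x hx => ne_of_lt hx))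

theorem stmt_6 (m : ℕ) (hm : 2 ≤ m)
    (lam : Fin (m - 1) → ℝ) (hmono : Monotone lam) (hlt : ∀ i, lam i < 1)
    (P Q Phat Qhat : Polynomial ℝ)
    (hP : P = ∏ i : Fin (m - 1), (X - C (2 * lam i / ((m : ℝ) + 1))))
    (hQder : ∀ y : ℝ, (derivative Q).eval y = ((m : ℝ) + 1) * y * P.eval y)
    (hQval : Q.eval (2 / ((m : ℝ) + 1)) = 0)
    (hPhat : ∀ x : ℝ, x ≠ 0 → Phat.eval x = x ^ (m - 1) * P.eval (1 / x))
    (hQhat : ∀ x : ℝ, x ≠ 0 → Qhat.eval x = x ^ (m + 1) * Q.eval (1 / x)) :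
    (∃ Z : ℝ → ℝ,
      (∃ c d : ℝ, Ioc (0 : ℝ) 1 ⊆ Ioo c d ∧ AnalyticOnNhd ℝ Z (Ioo c d)) ∧
      (∀ r ∈ Ioc (0 : ℝ) 1,
        r * deriv Z r * Phat.eval (Z r) + Qhat.eval (Z r) = 0) ∧
      Z 1 = 0 ∧
      (∀ r ∈ Ioc (0 : ℝ) 1, deriv Z r < 0)) ∧
    (∀ Z₁ Z₂ : ℝ → ℝ,
      (∃ c d : ℝ, Ioc (0 : ℝ) 1 ⊆ Ioo c d ∧ AnalyticOnNhd ℝ Z₁ (Ioo c d)) →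
      (∀ r ∈ Ioc (0 : ℝ) 1,
        r * deriv Z₁ r * Phat.eval (Z₁ r) + Qhat.eval (Z₁ r) = 0) →
      Z₁ 1 = 0 →
      (∃ c d : ℝ, Ioc (0 : ℝ) 1 ⊆ Ioo c d ∧ AnalyticOnNhd ℝ Z₂ (Ioo c d)) →
      (∀ r ∈ Ioc (0 : ℝ) 1,
        r * deriv Z₂ r * Phat.eval (Z₂ r) + Qhat.eval (Z₂ r) = 0) →
      Z₂ 1 = 0 →
      EqOn Z₁ Z₂ (Ioc (0 : ℝ) 1)) := by
  have hm1 : (0:ℝ) < (m:ℝ) + 1 := by positivity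
  set b : ℝ := 2 / ((m : ℝ) + 1) with hb
  have hb0 : 0 < b := by positivity
  have hPeval : ∀ y, P.eval y = ∏ i : Fin (m - 1), (y - 2 * lam i / ((m : ℝ) + 1)) := by
    intro y; rw [hP, eval_prod]; simp
  have hPpos : ∀ y, b ≤ y → 0 < P.eval y := by
    intro y hy
    rw [hPeval]
    refine Finset.prod_pos (fun i _ => ?_)
    have : 2 * lam i / ((m : ℝ) + 1) < b := by
      rw [hb]; gcongr; linarith [hlt i]
    linarith
  have hQpos : ∀ y, b < y → 0 < Q.eval y := by
    intro y hy
    rw [← hQval]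
    refine strictMonoOn_of_deriv_pos (convex_Ici b) Q.continuous.continuousOn ?_ self_mem_Ici hy.le hy
    intro x hx
    rw [interior_Ici] at hx
    have hx : b < x := hx
    rw [Polynomial.deriv, hQder]
    have := hPpos x hx.le
    have : 0 < x := hb0.trans hx
    positivity
  -- polynomial identities
  have ext0 : ∀ p q : Polynomial ℝ, (∀ x : ℝ, x ≠ 0 → p.eval x = q.eval x) → p = q := by
    intro p q h
    refine Polynomial.eq_of_infinite_eval_eq p q ?_
    exact (Set.finite_singleton (0:ℝ)).infinite_compl.mono (fun x hx => h x hx)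
  have hPh : Phat = ∏ i : Fin (m - 1), (1 - C (2 * lam i / ((m : ℝ) + 1)) * X) := by
    refine ext0 _ _ (fun x hx => ?_)
    rw [hPhat x hx, hPeval, eval_prod]
    have : x ^ (m - 1) = ∏ i : Fin (m - 1), x := by simp
    rw [this, ← Finset.prod_mul_distrib]
    refine Finset.prod_congr rfl (fun i _ => ?_)
    simp
    field_simp
  have hP0 : Phat.eval 0 = 1 := by rw [hPh, eval_prod]; simp
  have hid : X * derivative Qhat = C ((m:ℝ) + 1) * (Qhat - Phat) := by
    refine ext0 _ _ (fun x hx => ?_)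
    have h1 : HasDerivAt (fun x => Qhat.eval x) ((derivative Qhat).eval x) x := Qhat.hasDerivAt x
    have h2 : HasDerivAt (fun x : ℝ => x ^ (m + 1) * Q.eval (1 / x))
        (((m + 1 : ℕ) : ℝ) * x ^ m * Q.eval (1 / x) + x ^ (m + 1) * ((derivative Q).eval (1 / x) * (-(x ^ 2)⁻¹))) x := by
      have i1 : HasDerivAt (fun x : ℝ => 1 / x) (-(x ^ 2)⁻¹) x := by
        simpa using hasDerivAt_inv hx
      have i2 := (Q.hasDerivAt (1 / x)).comp x i1
      have i3 := (hasDerivAt_pow (m + 1) x).mul i2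
      exact i3
    have h3 := h1.unique (h2.congr_of_eventuallyEq (by
      filter_upwards [isOpen_ne.mem_nhds hx] with t ht using hQhat t ht))
    simp only [eval_mul, eval_X, eval_C, eval_sub]
    rw [h3, hQhat x hx, hPhat x hx, hQder]
    obtain ⟨k, rfl⟩ : ∃ k, m = k + 2 := ⟨m - 2, by omega⟩
    have : k + 2 - 1 = k + 1 := by omega
    rw [this]
    push_cast
    field_simp
    ring
  have hQ0 : Qhat.eval 0 = 1 := by
    have := congrArg (eval 0) hid
    simp only [eval_mul, eval_X, eval_C, eval_sub, zero_mul] at this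
    rcases mul_eq_zero.1 this.symm with h | h
    · linarith
    · linarith
  refine aux_main Phat Qhat (1 / b) (by positivity) ?_ ?_ ?_
  · rintro x ⟨h0, h1⟩
    rcases h0.eq_or_lt with h | h
    · rw [← h, hP0]; exact one_pos
    · rw [hPhat x h.ne']
      have := hPpos (1 / x) (by rw [le_div_iff₀ h]; rw [le_div_iff₀ hb0] at h1; linarith)
      positivity
  · rintro x ⟨h0, h1⟩
    rcases h0.eq_or_lt with h | h
    · rw [← h, hQ0]; exact one_pos
    · rw [hQhat x h.ne']
      have := hQpos (1 / x) (by rw [lt_div_iff₀ h]; rw [lt_div_iff₀ hb0] at h1; linarith)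
      positivity
  · rw [hQhat _ (by positivity), one_div_one_div, hQval, mul_zero]
end

section
/- With notation as in the context, there exists a unique real analytic function Z on [−1,1] (meaning Z extends real analytically to an open interval containing [−1,1]; uniqueness means any two such functions agree on [−1,1]) satisfying r·Z'(r)·P̂(Z(r)) + Q̂(Z(r)) = 0 for all r ∈ [−1,1] and Z(1) = 0. Moreover Z is an even function satisfying Z(0) = (m+1)/2, Z'(0) = 0, Z'(r) < 0 for all r ∈ (0,1], Z'(1) = −1, and Z''(0) < 0; consequently Z(r) ∈ (0, (m+1)/2) for all r ∈ (−1,0) ∪ (0,1). -/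
open Polynomial Set

lemma rat_prim_analytic (S T : Polynomial ℝ) (G : ℝ → ℝ) (U : Set ℝ) (hU : IsOpen U)
    (hS : ∀ x ∈ U, S.eval x ≠ 0)
    (hG : ∀ x ∈ U, HasDerivAt G (T.eval x / S.eval x) x) : AnalyticOnNhd ℝ G U := by
  intro x hx
  let f : ℂ → ℂ := fun z => aeval z T / aeval z S
  have hev : ∀ (p : Polynomial ℝ) (y : ℝ), aeval (y : ℂ) p = ((p.eval y : ℝ) : ℂ) := by
    intro p y
    exact Polynomial.aeval_algebraMap_apply_eq_algebraMap_eval y p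
  have hne : (aeval (x : ℂ) S) ≠ 0 := by
    rw [hev]; exact_mod_cast hS x hx
  have hcont : Continuous fun z : ℂ => aeval z S := S.continuous_aeval
  have h1 : ∀ᶠ z in nhds (x : ℂ), aeval z S ≠ 0 := hcont.continuousAt.eventually_ne hne
  obtain ⟨ε, hε, hb⟩ := Metric.eventually_nhds_iff_ball.1 h1
  obtain ⟨δ, hδ, hd⟩ := Metric.isOpen_iff.1 hU x hx
  have hdiff : DifferentiableOn ℂ f (Metric.ball (x : ℂ) ε) := by
    intro z hz
    exact ((T.differentiable_aeval z).div (S.differentiable_aeval z) (hb z hz)).differentiableWithinAt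
  obtain ⟨F, hF⟩ := hdiff.isExactOn_ball
  have hFa : AnalyticAt ℂ F x := by
    have : DifferentiableOn ℂ F (Metric.ball (x : ℂ) ε) := fun z hz =>
      (hF z hz).differentiableAt.differentiableWithinAt
    exact this.analyticAt (Metric.ball_mem_nhds _ hε)
  have hRa : AnalyticAt ℝ (fun y : ℝ => (F y).re) x := hFa.re_ofReal
  set η := min ε δ with hη
  have hη0 : 0 < η := lt_min hε hδ
  have hconst : ∀ y ∈ Metric.ball x η, G y - (F y).re = G x - (F x).re := by
    have hder : ∀ y ∈ Metric.ball x η, HasDerivAt (fun y : ℝ => G y - (F y).re) 0 y := by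
      intro y hy
      have hy' := Metric.mem_ball.1 hy
      have hyU : y ∈ U := hd (Metric.mem_ball.2 (lt_of_lt_of_le hy' (min_le_right _ _)))
      have hyε : (y : ℂ) ∈ Metric.ball (x : ℂ) ε := by
        rw [Metric.mem_ball, Complex.dist_of_im_eq (by simp)]
        simpa using lt_of_lt_of_le hy' (min_le_left _ _)
      have h2 := (hF y hyε).real_of_complex
      have h3 := (hG y hyU).sub h2
      refine HasDerivAt.congr_deriv h3 ?_
      change T.eval y / S.eval y - (aeval (y : ℂ) T / aeval (y : ℂ) S).re = 0
      rw [hev, hev, ← Complex.ofReal_div, Complex.ofReal_re]; ring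
    intro y hy
    refine (convex_ball x η).is_const_of_fderivWithin_eq_zero (𝕜 := ℝ) (f := fun y : ℝ => G y - (F y).re)
      (fun z hz => (hder z hz).differentiableAt.differentiableWithinAt) ?_ hy (Metric.mem_ball_self hη0)
    intro z hz
    rw [fderivWithin_of_isOpen Metric.isOpen_ball hz]
    ext; simp [(hder z hz).deriv]
  have : G =ᶠ[nhds x] fun y : ℝ => (F y).re + (G x - (F x).re) := by
    filter_upwards [Metric.ball_mem_nhds x hη0] with y hy
    linarith [hconst y hy]
  exact (hRa.add analyticAt_const).congr this.symm

lemma inv_exists (H : ℝ → ℝ) (b α β : ℝ) (hb : 0 < b) (hα : α < 0) (hβ : b < β)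
    (hH : AnalyticOnNhd ℝ H (Ioo α β)) (hH' : ∀ x ∈ Ioo α β, deriv H x < 0)
    (h0 : H 0 = 1) (h1 : H b = 0) :
    ∃ (W : ℝ → ℝ) (c d : ℝ), c < 0 ∧ 1 < d ∧ AnalyticOnNhd ℝ W (Ioo c d) ∧
      (∀ s ∈ Ioo c d, W s ∈ Ioo α β ∧ H (W s) = s) ∧ (∀ x ∈ Ioo α β, W (H x) = x) ∧
      StrictAntiOn H (Ioo α β) := by
  have hanti : StrictAntiOn H (Ioo α β) := by
    refine strictAntiOn_of_deriv_neg (convex_Ioo _ _) hH.continuousOn ?_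
    simpa using hH'
  have hinv : ∀ x ∈ Ioo α β, Function.invFunOn H (Ioo α β) (H x) = x := fun x hx =>
    hanti.injOn.leftInvOn_invFunOn hx
  have m1 : α/2 ∈ Ioo α β := ⟨by linarith, by linarith⟩
  have m2 : (b+β)/2 ∈ Ioo α β := ⟨by linarith, by linarith⟩
  have m3 : (0:ℝ) ∈ Ioo α β := ⟨by linarith, by linarith⟩
  have m4 : b ∈ Ioo α β := ⟨by linarith, by linarith⟩
  have hsurj : ∀ s ∈ Ioo (H ((b+β)/2)) (H (α/2)), ∃ x ∈ Ioo α β, H x = s := by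
    intro s hs
    have hsub : Icc (α/2) ((b+β)/2) ⊆ Ioo α β := fun x hx => ⟨by linarith [hx.1], by linarith [hx.2]⟩
    obtain ⟨x, hx, hxs⟩ := intermediate_value_Icc' (by linarith : α/2 ≤ (b+β)/2)
      (hH.continuousOn.mono hsub) (Ioo_subset_Icc_self hs)
    exact ⟨x, hsub hx, hxs⟩
  refine ⟨Function.invFunOn H (Ioo α β), H ((b+β)/2), H (α/2), ?_, ?_, ?_, ?_, hinv, hanti⟩
  · rw [← h1]; exact hanti m4 m2 (by linarith)
  · rw [← h0]; exact hanti m1 m3 (by linarith)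
  · intro s hs
    obtain ⟨x, hx, rfl⟩ := hsurj s hs
    rw [← analyticAt_comp_iff_of_deriv_ne_zero (hH x hx) (hH' x hx).ne]
    refine analyticAt_id.congr ?_
    filter_upwards [isOpen_Ioo.mem_nhds hx] with y hy
    simp [hinv y hy]
  · intro s hs
    obtain ⟨x, hx, rfl⟩ := hsurj s hs
    rw [hinv x hx]; exact ⟨hx, rfl⟩

lemma pos_ext (b : ℝ) (hb : 0 < b) (p S : Polynomial ℝ)
    (hp : ∀ x ∈ Icc 0 b, 0 < p.eval x) (hS : ∀ x ∈ Icc 0 b, 0 < S.eval x) :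
    ∃ α β : ℝ, α < 0 ∧ b < β ∧ ∀ x ∈ Ioo α β, 0 < p.eval x ∧ 0 < S.eval x := by
  have ho : IsOpen {x : ℝ | 0 < p.eval x ∧ 0 < S.eval x} :=
    (isOpen_lt continuous_const p.continuous).inter (isOpen_lt continuous_const S.continuous)
  obtain ⟨ε, hε, h1⟩ := Metric.isOpen_iff.1 ho 0 ⟨hp 0 ⟨le_rfl, hb.le⟩, hS 0 ⟨le_rfl, hb.le⟩⟩
  obtain ⟨δ, hδ, h2⟩ := Metric.isOpen_iff.1 ho b ⟨hp b ⟨hb.le, le_rfl⟩, hS b ⟨hb.le, le_rfl⟩⟩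
  refine ⟨-ε, b + δ, by linarith, by linarith, fun x hx => ?_⟩
  rcases lt_or_ge x 0 with h | h
  · exact h1 (by rw [Metric.mem_ball, Real.dist_eq, abs_lt]; constructor <;> linarith [hx.1])
  rcases le_or_gt x b with h' | h'
  · exact ⟨hp x ⟨h, h'⟩, hS x ⟨h, h'⟩⟩
  · exact h2 (by rw [Metric.mem_ball, Real.dist_eq, abs_lt]; constructor <;> linarith [hx.2])

lemma H_exists (b : ℝ) (hb : 0 < b) (p S T : Polynomial ℝ) (α β : ℝ) (hα : α < 0) (hβ : b < β)
    (hST : ∀ x, 2 * p.eval x - S.eval x = (b - x) * T.eval x)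
    (hpos : ∀ x ∈ Ioo α β, 0 < p.eval x ∧ 0 < S.eval x) :
    ∃ H h : ℝ → ℝ, AnalyticOnNhd ℝ H (Ioo α β) ∧ (∀ x, 0 < h x) ∧ H 0 = 1 ∧
      (∀ x, H x = (1 - x / b) * h x) ∧
      (∀ x ∈ Ioo α β, HasDerivAt H (-(2 / b) * h x * p.eval x / S.eval x) x) := by
  let G : ℝ → ℝ := fun x => ∫ t in (0:ℝ)..x, T.eval t / S.eval t
  have hc : ContinuousOn (fun t => T.eval t / S.eval t) (Ioo α β) := fun x hx =>
    (T.continuous.continuousAt.div S.continuous.continuousAt (hpos x hx).2.ne').continuousWithinAt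
  have h0 : (0:ℝ) ∈ Ioo α β := ⟨hα, hb.trans hβ⟩
  have hG : ∀ x ∈ Ioo α β, HasDerivAt G (T.eval x / S.eval x) x := by
    intro x hx
    refine intervalIntegral.integral_hasDerivAt_right ?_ ?_ (hc.continuousAt (isOpen_Ioo.mem_nhds hx))
    · exact (hc.mono (ordConnected_Ioo.uIcc_subset h0 hx)).intervalIntegrable
    · exact hc.stronglyMeasurableAtFilter isOpen_Ioo x hx
  have hGa := rat_prim_analytic S T G _ isOpen_Ioo (fun x hx => (hpos x hx).2.ne') hG
  refine ⟨fun x => (1 - x / b) * Real.exp (-G x), fun x => Real.exp (-G x), ?_, fun x => Real.exp_pos _,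
    by simp [G], fun x => rfl, ?_⟩
  · intro x hx
    have := hGa x hx
    fun_prop (disch := exact hb.ne')
  · intro x hx
    have h1 : HasDerivAt (fun x : ℝ => 1 - x / b) (-(1 / b)) x := by
      simpa using ((hasDerivAt_id x).div_const b).const_sub 1
    have h2 := h1.mul (hG x hx).neg.exp
    have hS := (hpos x hx).2.ne'
    refine HasDerivAt.congr_deriv h2 ?_
    have := hST x
    have hp : p.eval x = ((b - x) * T.eval x + S.eval x) / 2 := by linarith
    simp only [Pi.neg_apply]
    rw [hp]
    field_simp
    ring

lemma core (b : ℝ) (hb : 0 < b) (p q S T : Polynomial ℝ)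
    (hq : ∀ x, q.eval x = (b - x) * S.eval x)
    (hST : ∀ x, 2 * p.eval x - S.eval x = (b - x) * T.eval x)
    (hp : ∀ x ∈ Icc 0 b, 0 < p.eval x) (hS : ∀ x ∈ Icc 0 b, 0 < S.eval x)
    (hp0 : p.eval 0 = 1) (hq0 : q.eval 0 = 1) :
    ∃ Z : ℝ → ℝ,
      (∃ c d : ℝ, c < -1 ∧ 1 < d ∧ AnalyticOnNhd ℝ Z (Ioo c d)) ∧
      (∀ r ∈ Icc (-1 : ℝ) 1,
        r * deriv Z r * p.eval (Z r) + q.eval (Z r) = 0) ∧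
      Z 1 = 0 ∧
      (∀ Z' : ℝ → ℝ,
        (∃ c d : ℝ, c < -1 ∧ 1 < d ∧ AnalyticOnNhd ℝ Z' (Ioo c d)) →
        (∀ r ∈ Icc (-1 : ℝ) 1,
          r * deriv Z' r * p.eval (Z' r) + q.eval (Z' r) = 0) →
        Z' 1 = 0 →
        EqOn Z Z' (Icc (-1 : ℝ) 1)) ∧
      (∀ r ∈ Icc (-1 : ℝ) 1, Z (-r) = Z r) ∧
      Z 0 = b ∧
      deriv Z 0 = 0 ∧
      (∀ r ∈ Ioc (0 : ℝ) 1, deriv Z r < 0) ∧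
      deriv Z 1 = -1 ∧
      deriv (deriv Z) 0 < 0 ∧
      (∀ r ∈ Ioo (-1 : ℝ) 1, r ≠ 0 → Z r ∈ Ioo (0 : ℝ) b) := by
  obtain ⟨α, β, hα, hβ, hpos⟩ := pos_ext b hb p S hp hS
  obtain ⟨H, h, hHa, hh, hH0, hHh, hHd⟩ := H_exists b hb p S T α β hα hβ hST hpos
  have hHneg : ∀ x ∈ Ioo α β, deriv H x < 0 := by
    intro x hx
    rw [(hHd x hx).deriv]
    obtain ⟨h1, h2⟩ := hpos x hx
    have h3 := hh x
    have : 0 < (2 / b) * h x * p.eval x / S.eval x := by positivity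
    have e : -(2 / b) * h x * p.eval x / S.eval x = -((2 / b) * h x * p.eval x / S.eval x) := by ring
    linarith
  have hHb : H b = 0 := by rw [hHh]; field_simp; simp
  obtain ⟨W, c, d, hc, hd, hWa, hHW, hWH, hanti⟩ := inv_exists H b α β hb hα hβ hHa hHneg hH0 hHb
  have m0 : (0:ℝ) ∈ Ioo α β := ⟨hα, hb.trans hβ⟩
  have mb : b ∈ Ioo α β := ⟨hα.trans hb, hβ⟩
  have hW1 : W 1 = 0 := by rw [← hH0, hWH 0 m0]
  have hW0 : W 0 = b := by rw [← hHb, hWH b mb]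
  have hWder : ∀ s ∈ Ioo c d, deriv W s < 0 ∧
      2 * s * deriv W s * p.eval (W s) + q.eval (W s) = 0 := by
    intro s hs
    obtain ⟨hx, hxs⟩ := hHW s hs
    have h1 : HasDerivAt (fun t => H (W t)) _ s :=
      (hHd (W s) hx).comp s (hWa s hs).differentiableAt.hasDerivAt
    have h2 : HasDerivAt (fun t => H (W t)) 1 s := by
      refine (hasDerivAt_id s).congr_of_eventuallyEq ?_
      filter_upwards [isOpen_Ioo.mem_nhds hs] with t ht
      exact (hHW t ht).2
    have h3 := h1.unique h2
    obtain ⟨hp1, hS1⟩ := hpos _ hx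
    have hh1 := hh (W s)
    have h4 : 2 * h (W s) * p.eval (W s) * deriv W s = - (b * S.eval (W s)) := by
      field_simp at h3
      linarith
    constructor
    · by_contra hcon
      push Not at hcon
      have : 0 ≤ 2 * h (W s) * p.eval (W s) * deriv W s := by positivity
      have : 0 < b * S.eval (W s) := by positivity
      linarith
    · rw [hq]
      have h5 : b * s = (b - W s) * h (W s) := by
        rw [hHh] at hxs
        field_simp at hxs
        linarith
      have h6 : h (W s) * b * (2 * s * deriv W s * p.eval (W s) + (b - W s) * S.eval (W s)) = 0 := by
        linear_combination (b * s) * h4 - (b * S.eval (W s)) * h5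
      have h7 : h (W s) * b ≠ 0 := by positivity
      exact (mul_eq_zero.1 h6).resolve_left h7
  have hd0 : 0 < d := by linarith
  have hsd : 1 < √d := by rw [Real.lt_sqrt] <;> linarith
  have hsq : ∀ r ∈ Ioo (-√d) (√d), r ^ 2 ∈ Ioo c d := by
    intro r hr
    refine ⟨by nlinarith [sq_nonneg r], ?_⟩
    have : r ^ 2 < (√d) ^ 2 := sq_lt_sq' hr.1 hr.2
    rwa [Real.sq_sqrt hd0.le] at this
  have hsub : ∀ r ∈ Icc (-1:ℝ) 1, r ∈ Ioo (-√d) (√d) := fun r hr =>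
    ⟨by linarith [hr.1], by linarith [hr.2]⟩
  have hZd : ∀ r ∈ Ioo (-√d) (√d), HasDerivAt (fun r => W (r ^ 2)) (deriv W (r ^ 2) * (2 * r)) r := by
    intro r hr
    have h1 : HasDerivAt (fun r : ℝ => r ^ 2) (2 * r) r := by simpa using hasDerivAt_pow 2 r
    exact HasDerivAt.comp (h := fun r : ℝ => r ^ 2) r (hWa _ (hsq r hr)).differentiableAt.hasDerivAt h1
  have hZa : AnalyticOnNhd ℝ (fun r => W (r ^ 2)) (Ioo (-√d) (√d)) := by
    intro r hr
    exact (hWa _ (hsq r hr)).fun_comp (f := fun r : ℝ => r ^ 2) (by fun_prop)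
  have hode : ∀ r ∈ Icc (-1 : ℝ) 1,
      r * deriv (fun r => W (r ^ 2)) r * p.eval (W (r ^ 2)) + q.eval (W (r ^ 2)) = 0 := by
    intro r hr
    rw [(hZd r (hsub r hr)).deriv]
    linear_combination (hWder _ (hsq r (hsub r hr))).2
  refine ⟨fun r => W (r ^ 2), ⟨-√d, √d, by linarith, hsd, hZa⟩, hode, by simpa using hW1,
    ?_, by simp, by simpa using hW0, ?_, ?_, ?_, ?_, ?_⟩
  · rintro Y ⟨c', d', hc', hd', hYa⟩ hYode hY1
    have hYE : AnalyticOnNhd ℝ (fun r => r * deriv Y r * p.eval (Y r) + q.eval (Y r)) (Ioo c' d') := by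
      intro r hr
      have h1 := hYa r hr
      have h2 := h1.deriv
      have h3 : AnalyticAt ℝ (fun r => p.eval (Y r)) r := h1.aeval_polynomial p
      have h4 : AnalyticAt ℝ (fun r => q.eval (Y r)) r := h1.aeval_polynomial q
      fun_prop
    have hE0 : EqOn (fun r => r * deriv Y r * p.eval (Y r) + q.eval (Y r)) 0 (Ioo c' d') := by
      refine hYE.eqOn_zero_of_preconnected_of_eventuallyEq_zero isPreconnected_Ioo
        (z₀ := 0) ⟨by linarith, by linarith⟩ ?_
      filter_upwards [Icc_mem_nhds (by norm_num : (-1:ℝ) < 0) one_pos] with r hr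
      exact hYode r hr
    have m1 : (1:ℝ) ∈ Ioo c' d' := ⟨by linarith, hd'⟩
    have hev : ∀ᶠ r in nhds (1:ℝ), r ∈ Ioo c' d' ∧ 0 < r ∧ Y r ∈ Ioo α β := by
      refine (isOpen_Ioo.mem_nhds m1 |> Filter.Eventually.and <| (lt_mem_nhds one_pos).and ?_)
      exact (hYa 1 m1).continuousAt.eventually (by rw [hY1]; exact isOpen_Ioo.mem_nhds m0)
    obtain ⟨ε, hε, hball⟩ := Metric.eventually_nhds_iff_ball.1 hev
    have hKd : ∀ r ∈ Metric.ball (1:ℝ) ε, HasDerivAt (fun r => H (Y r) / r ^ 2) 0 r := by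
      intro r hr
      obtain ⟨hr1, hr2, hr3⟩ := hball r hr
      have h1 : HasDerivAt (fun r : ℝ => r ^ 2) (2 * r) r := by simpa using hasDerivAt_pow 2 r
      have h2 : HasDerivAt (fun r => H (Y r)) _ r :=
        (hHd (Y r) hr3).comp r (hYa r hr1).differentiableAt.hasDerivAt
      have h3 := h2.div h1 (by positivity)
      refine HasDerivAt.congr_deriv h3 ?_
      have h4 : r * deriv Y r * p.eval (Y r) + q.eval (Y r) = 0 := hE0 hr1
      rw [hq] at h4
      obtain ⟨hp1, hS1⟩ := hpos _ hr3
      rw [div_eq_zero_iff]; left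
      rw [hHh]
      field_simp
      linear_combination (-2 * r * h (Y r)) * h4
    have hconst : ∀ r ∈ Metric.ball (1:ℝ) ε, H (Y r) / r ^ 2 = 1 := by
      intro r hr
      have := (convex_ball (1:ℝ) ε).is_const_of_fderivWithin_eq_zero (𝕜 := ℝ)
        (f := fun r => H (Y r) / r ^ 2)
        (fun z hz => (hKd z hz).differentiableAt.differentiableWithinAt) ?_ hr (Metric.mem_ball_self hε)
      · simpa [hY1, hH0] using this
      intro z hz
      rw [fderivWithin_of_isOpen Metric.isOpen_ball hz]
      ext; simp [(hKd z hz).deriv]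
    have hfin : EqOn (fun r => W (r ^ 2)) Y (Ioo (max c' (-√d)) (min d' (√d))) := by
      have s1 : Ioo (max c' (-√d)) (min d' (√d)) ⊆ Ioo (-√d) (√d) :=
        Ioo_subset_Ioo (le_max_right _ _) (min_le_right _ _)
      have s2 : Ioo (max c' (-√d)) (min d' (√d)) ⊆ Ioo c' d' :=
        Ioo_subset_Ioo (le_max_left _ _) (min_le_left _ _)
      refine (hZa.mono s1).eqOn_of_preconnected_of_eventuallyEq (hYa.mono s2) isPreconnected_Ioo
        (z₀ := 1) ⟨max_lt (by linarith) (by linarith), lt_min hd' hsd⟩ ?_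
      filter_upwards [Metric.ball_mem_nhds (1:ℝ) hε] with r hr
      obtain ⟨hr1, hr2, hr3⟩ := hball r hr
      have h1 := hconst r hr
      have h2 : H (Y r) = r ^ 2 := by field_simp at h1; exact h1
      rw [← h2, hWH _ hr3]
    intro r hr
    exact hfin ⟨max_lt (by linarith [hr.1]) (by linarith [hr.1]),
      lt_min (by linarith [hr.2]) (by linarith [hr.2])⟩
  · rw [(hZd 0 (hsub 0 (by simp))).deriv]; simp
  · intro r hr
    have hr' := hsub r ⟨by linarith [hr.1], hr.2⟩
    rw [(hZd r hr').deriv]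
    exact mul_neg_of_neg_of_pos (hWder _ (hsq r hr')).1 (by linarith [hr.1])
  · have h1 := hode 1 (by simp)
    simp only [one_pow, hW1, hp0, hq0] at h1
    linarith
  · have m00 : (0:ℝ) ∈ Ioo (-√d) (√d) := hsub 0 (by simp)
    have h1 : deriv (fun r => W (r ^ 2)) =ᶠ[nhds 0] fun r => deriv W (r ^ 2) * (2 * r) := by
      filter_upwards [isOpen_Ioo.mem_nhds m00] with r hr
      exact (hZd r hr).deriv
    rw [h1.deriv_eq]
    have m000 : (0:ℝ) ∈ Ioo c d := ⟨hc, hd0⟩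
    have h2 : DifferentiableAt ℝ (fun r : ℝ => deriv W (r ^ 2)) 0 := by
      have h3 : DifferentiableAt ℝ (deriv W) ((0:ℝ) ^ 2) := by
        simpa using (hWa 0 m000).deriv.differentiableAt
      exact DifferentiableAt.comp (f := fun r : ℝ => r ^ 2) (0:ℝ) h3 (by fun_prop)
    have h4 : HasDerivAt (fun r : ℝ => 2 * r) 2 0 := by
      simpa using (hasDerivAt_id (0:ℝ)).const_mul 2
    have h5 := (h2.hasDerivAt.mul h4).deriv
    have h6 : deriv (fun r : ℝ => deriv W (r ^ 2) * (2 * r)) 0 = deriv W 0 * 2 := by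
      refine Eq.trans h5 ?_
      simp
    rw [h6]
    have := (hWder 0 m000).1
    linarith
  · intro r hr hr0
    have hr' := hsub r (Ioo_subset_Icc_self hr)
    obtain ⟨h1, h2⟩ := hHW _ (hsq r hr')
    have h3 : 0 < r ^ 2 := by positivity
    have h4 : r ^ 2 < 1 := by nlinarith [hr.1, hr.2]
    constructor
    · exact (hanti.lt_iff_gt h1 m0).1 (by rw [h2, hH0]; exact h4)
    · exact (hanti.lt_iff_gt mb h1).1 (by rw [h2, hHb]; exact h3)

lemma poly_ext (p q : Polynomial ℝ) (h : ∀ x : ℝ, x ≠ 0 → p.eval x = q.eval x) : p = q := by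
  refine Polynomial.eq_of_infinite_eval_eq p q ?_
  exact (Set.Ioi_infinite (0:ℝ)).mono fun x hx => h x (ne_of_gt hx)

/-- Proposition 3.8 (1) of the paper: existence and uniqueness of
the real analytic solution Z on [−1,1] (extending to an open interval containing
[−1,1]) of the ODE with Z(1) = 0, together with its additional properties. -/
theorem stmt_12 (m : ℕ) (hm : 2 ≤ m)
    (lam : Fin (m - 1) → ℝ) (hmono : Monotone lam) (hlt : ∀ i, lam i < 1)
    (P Q Phat Qhat : Polynomial ℝ)
    (hP : P = ∏ i : Fin (m - 1), (X - C (2 * lam i / ((m : ℝ) + 1))))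
    (hQder : ∀ y : ℝ, (derivative Q).eval y = ((m : ℝ) + 1) * y * P.eval y)
    (hQval : Q.eval (2 / ((m : ℝ) + 1)) = 0)
    (hPhat : ∀ x : ℝ, x ≠ 0 → Phat.eval x = x ^ (m - 1) * P.eval (1 / x))
    (hQhat : ∀ x : ℝ, x ≠ 0 → Qhat.eval x = x ^ (m + 1) * Q.eval (1 / x)) :
    ∃ Z : ℝ → ℝ,
      (∃ c d : ℝ, c < -1 ∧ 1 < d ∧ AnalyticOnNhd ℝ Z (Ioo c d)) ∧
      (∀ r ∈ Icc (-1 : ℝ) 1,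
        r * deriv Z r * Phat.eval (Z r) + Qhat.eval (Z r) = 0) ∧
      Z 1 = 0 ∧
      (∀ Z' : ℝ → ℝ,
        (∃ c d : ℝ, c < -1 ∧ 1 < d ∧ AnalyticOnNhd ℝ Z' (Ioo c d)) →
        (∀ r ∈ Icc (-1 : ℝ) 1,
          r * deriv Z' r * Phat.eval (Z' r) + Qhat.eval (Z' r) = 0) →
        Z' 1 = 0 →
        EqOn Z Z' (Icc (-1 : ℝ) 1)) ∧
      (∀ r ∈ Icc (-1 : ℝ) 1, Z (-r) = Z r) ∧
      Z 0 = ((m : ℝ) + 1) / 2 ∧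
      deriv Z 0 = 0 ∧
      (∀ r ∈ Ioc (0 : ℝ) 1, deriv Z r < 0) ∧
      deriv Z 1 = -1 ∧
      deriv (deriv Z) 0 < 0 ∧
      (∀ r ∈ Ioo (-1 : ℝ) 1, r ≠ 0 → Z r ∈ Ioo (0 : ℝ) (((m : ℝ) + 1) / 2)) := by
  have hm1 : (0:ℝ) < (m:ℝ) + 1 := by positivity
  have hb : (0:ℝ) < ((m : ℝ) + 1) / 2 := by positivity
  have hPpos : ∀ y : ℝ, 2 / ((m : ℝ) + 1) ≤ y → 0 < P.eval y := by
    intro y hy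
    rw [hP, Polynomial.eval_prod]
    refine Finset.prod_pos fun i _ => ?_
    have h1 : 2 * lam i / ((m : ℝ) + 1) < 2 / ((m : ℝ) + 1) := by
      rw [div_lt_div_iff_of_pos_right hm1]
      linarith [hlt i]
    simp only [eval_sub, eval_X, eval_C]
    linarith
  have hPh0 : Phat.eval 0 = 1 := by
    have : Phat = ∏ i : Fin (m - 1), (1 - C (2 * lam i / ((m : ℝ) + 1)) * X) := by
      refine poly_ext _ _ fun x hx => ?_
      rw [hPhat x hx, hP, Polynomial.eval_prod, Polynomial.eval_prod]
      have : x ^ (m - 1) = ∏ i : Fin (m - 1), x := by simp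
      rw [this, ← Finset.prod_mul_distrib]
      refine Finset.prod_congr rfl fun i _ => ?_
      simp only [eval_sub, eval_X, eval_C, eval_one, eval_mul]
      field_simp
    rw [this, Polynomial.eval_prod]
    simp
  have hrel : X * derivative Qhat = C ((m:ℝ) + 1) * (Qhat - Phat) := by
    refine poly_ext _ _ fun x hx => ?_
    have h1 : HasDerivAt (fun x : ℝ => Qhat.eval x) ((derivative Qhat).eval x) x := Qhat.hasDerivAt x
    have h2 : HasDerivAt (fun x : ℝ => Q.eval (x⁻¹)) ((derivative Q).eval (x⁻¹) * (-(x ^ 2)⁻¹)) x :=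
      HasDerivAt.comp (h := fun x : ℝ => x⁻¹) x (Q.hasDerivAt x⁻¹) (hasDerivAt_inv hx)
    have h3 := (hasDerivAt_pow (m + 1) x).mul h2
    have h4 := h3.congr_of_eventuallyEq (f₁ := fun x : ℝ => Qhat.eval x) (by
      filter_upwards [isOpen_ne.mem_nhds hx] with y hy
      rw [hQhat y hy, one_div]; rfl)
    have h5 := h1.unique h4
    simp only [eval_mul, eval_X, eval_C, eval_sub]
    rw [h5, hQhat x hx, hPhat x hx, hQder, one_div]
    obtain ⟨k, rfl⟩ : ∃ k, m = k + 1 := ⟨m - 1, by omega⟩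
    simp only [Nat.add_sub_cancel]
    push_cast
    field_simp
    ring
  have hrel' : ∀ x : ℝ, x * (derivative Qhat).eval x = ((m:ℝ) + 1) * (Qhat.eval x - Phat.eval x) := by
    intro x
    have := congrArg (fun p => Polynomial.eval x p) hrel
    simpa using this
  have hQh0 : Qhat.eval 0 = 1 := by
    have h1 := hrel' 0
    rw [zero_mul] at h1
    have h2 := (mul_eq_zero.1 h1.symm).resolve_left hm1.ne'
    linarith
  have hinvb : 1 / (((m : ℝ) + 1) / 2) = 2 / ((m : ℝ) + 1) := by field_simp
  have hQhb : Qhat.eval (((m : ℝ) + 1) / 2) = 0 := by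
    rw [hQhat _ hb.ne', hinvb, hQval, mul_zero]
  have hQ'b : (derivative Qhat).eval (((m : ℝ) + 1) / 2) = -2 * Phat.eval (((m : ℝ) + 1) / 2) := by
    have h1 := hrel' (((m : ℝ) + 1) / 2)
    rw [hQhb] at h1
    field_simp at h1
    linarith
  have hPhpos : ∀ x ∈ Icc 0 (((m : ℝ) + 1) / 2), 0 < Phat.eval x := by
    intro x hx
    rcases eq_or_lt_of_le hx.1 with h | h
    · rw [← h, hPh0]; exact one_pos
    · rw [hPhat x h.ne']
      refine mul_pos (pow_pos h _) (hPpos _ ?_)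
      rw [← hinvb]
      exact one_div_le_one_div_of_le h hx.2
  have hQmono : StrictMonoOn (fun y => Q.eval y) (Ici (2 / ((m : ℝ) + 1))) := by
    refine strictMonoOn_of_deriv_pos (convex_Ici _) Q.continuous.continuousOn ?_
    intro y hy
    rw [interior_Ici] at hy
    have hy0 : 0 < y := lt_trans (by positivity) hy
    have := hPpos y (le_of_lt hy)
    rw [Polynomial.deriv, hQder]
    positivity
  have hQhpos : ∀ x ∈ Ico 0 (((m : ℝ) + 1) / 2), 0 < Qhat.eval x := by
    intro x hx
    rcases eq_or_lt_of_le hx.1 with h | h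
    · rw [← h, hQh0]; exact one_pos
    · rw [hQhat x h.ne']
      refine mul_pos (pow_pos h _) ?_
      have h1 : 2 / ((m : ℝ) + 1) < 1 / x := by
        rw [← hinvb]
        exact one_div_lt_one_div_of_lt h hx.2
      have h2 := hQmono (mem_Ici.2 le_rfl) (mem_Ici.2 h1.le) h1
      simp only [hQval] at h2
      exact h2
  obtain ⟨S, hS⟩ := Polynomial.dvd_iff_isRoot.2 hQhb
  have hSb : S.eval (((m : ℝ) + 1) / 2) = -2 * Phat.eval (((m : ℝ) + 1) / 2) := by
    rw [← hQ'b, hS]; simp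
  have hTb : (C 2 * Phat + S).IsRoot (((m : ℝ) + 1) / 2) := by
    simp [Polynomial.IsRoot, hSb]
  obtain ⟨T, hT⟩ := Polynomial.dvd_iff_isRoot.2 hTb
  have hSe : ∀ x, Qhat.eval x = (((m : ℝ) + 1) / 2 - x) * (-S).eval x := by
    intro x
    rw [hS]; simp only [eval_mul, eval_sub, eval_X, eval_C, eval_neg]; ring
  refine core (((m : ℝ) + 1) / 2) hb Phat Qhat (-S) (-T) hSe ?_ hPhpos ?_ hPh0 hQh0
  · intro x
    have := congrArg (fun p => Polynomial.eval x p) hT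
    simp only [eval_mul, eval_add, eval_sub, eval_X, eval_C] at this
    simp only [eval_neg]
    linarith
  · intro x hx
    rcases eq_or_lt_of_le hx.2 with h | h
    · rw [h, eval_neg, hSb]
      have := hPhpos _ ⟨hb.le, le_refl (((m : ℝ) + 1) / 2)⟩
      linarith
    · have h1 := hQhpos x ⟨hx.1, h⟩
      rw [hSe] at h1
      exact (pos_iff_pos_of_mul_pos h1).1 (by linarith)
end

section
/- With notation as in the context, there exists a unique real analytic function ξ on [−1,1] (meaning ξ extends real analytically to an open interval containing [−1,1]; uniqueness means any two such functions agree on [−1,1]) satisfying r·ξ'(r) = −c·ξ(r)^{m+1} + a·ξ(r) − 1 for all r ∈ [−1,1] and ξ(1) = 0. Moreover ξ is even, ξ(r) > 0 for all r ∈ (−1,1), and ξ'(r) < 0 for all r ∈ (0,1]; and the function φ(r) := 2·(r/(−ξ'(r)))^{1/(m+1)}·ξ(r), defined for r ∈ (0,1), satisfies r·ξ(r)·φ'(r) + (1 − α·ξ(r))·φ(r) = 0 for all r ∈ (0,1). -/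
open Set

open Polynomial Filter Topology in
lemma aux_prim_s14 (R G : ℝ[X]) (L : ℝ → ℝ) (x₁ : ℝ) (hG : G.eval x₁ ≠ 0)
    (hL : ∀ᶠ x in 𝓝 x₁, HasDerivAt L (R.eval x / G.eval x) x) : AnalyticAt ℝ L x₁ := by
  let Rc := R.map Complex.ofRealHom
  let Gc := G.map Complex.ofRealHom
  have eR : ∀ x : ℝ, Rc.eval (x : ℂ) = ((R.eval x : ℝ) : ℂ) := fun x => by
    simpa [Rc] using (Polynomial.eval_map_apply (p := R) Complex.ofRealHom x)
  have eG : ∀ x : ℝ, Gc.eval (x : ℂ) = ((G.eval x : ℝ) : ℂ) := fun x => by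
    simpa [Gc] using (Polynomial.eval_map_apply (p := G) Complex.ofRealHom x)
  have hG' : Gc.eval (x₁ : ℂ) ≠ 0 := by rw [eG]; exact_mod_cast hG
  have h1 : ∀ᶠ z in 𝓝 (x₁ : ℂ), Gc.eval z ≠ 0 :=
    Gc.continuous.continuousAt.eventually_ne hG'
  obtain ⟨ε, hε, hb⟩ := Metric.eventually_nhds_iff_ball.1 h1
  have hd : DifferentiableOn ℂ (fun z => Rc.eval z / Gc.eval z) (Metric.ball (x₁ : ℂ) ε) := by
    intro z hz
    exact (Rc.differentiableAt.div Gc.differentiableAt (hb z hz)).differentiableWithinAt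
  obtain ⟨g, hg⟩ := hd.isExactOn_ball
  have hga : AnalyticAt ℂ g (x₁ : ℂ) := by
    rw [Complex.analyticAt_iff_eventually_differentiableAt]
    filter_upwards [Metric.ball_mem_nhds _ hε] with z hz
    exact (hg z hz).differentiableAt
  have hKa : AnalyticAt ℝ (fun x : ℝ => (g (x : ℂ)).re) x₁ := by
    have h2 : AnalyticAt ℝ g (x₁ : ℂ) := hga.restrictScalars
    have h3 : AnalyticAt ℝ (fun x : ℝ => g (x : ℂ)) x₁ :=
      AnalyticAt.fun_comp (g := g) (f := fun x : ℝ => (x : ℂ)) h2 (Complex.ofRealCLM.analyticAt x₁)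
    exact (Complex.reCLM.analyticAt _).fun_comp h3
  obtain ⟨δ, hδ, hLb⟩ := Metric.eventually_nhds_iff_ball.1 hL
  have hK : ∀ x ∈ Metric.ball x₁ ε, HasDerivAt (fun x : ℝ => (g (x : ℂ)).re)
      (R.eval x / G.eval x) x := by
    intro x hx
    have h4 := (hg (x : ℂ) (by
      rw [Metric.mem_ball] at hx ⊢
      rwa [Complex.dist_of_im_eq (by simp)] )).real_of_complex
    beta_reduce at h4
    rw [eR, eG, ← Complex.ofReal_div, Complex.ofReal_re] at h4
    exact h4
  have hev : (fun x => (g (x : ℂ)).re + (L x₁ - (g (x₁ : ℂ)).re)) =ᶠ[𝓝 x₁] L := by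
    have hm : 0 < min ε δ := lt_min hε hδ
    have hconst : ∀ x ∈ Metric.ball x₁ (min ε δ),
        L x - (g (x : ℂ)).re = L x₁ - (g (x₁ : ℂ)).re := by
      intro x hx
      have hdx : ∀ y ∈ Metric.ball x₁ (min ε δ),
          HasDerivAt (fun x : ℝ => L x - (g (x : ℂ)).re) 0 y := by
        intro y hy
        have := (hLb y (Metric.ball_subset_ball (min_le_right _ _) hy)).sub
          (hK y (Metric.ball_subset_ball (min_le_left _ _) hy))
        simpa using! this
      exact Metric.isOpen_ball.is_const_of_deriv_eq_zero (convex_ball x₁ _).isPreconnected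
        (fun y hy => (hdx y hy).differentiableAt.differentiableWithinAt)
        (fun y hy => (hdx y hy).deriv) hx (Metric.mem_ball_self hm)
    filter_upwards [Metric.ball_mem_nhds _ hm] with x hx
    have := hconst x hx
    linarith
  exact (hKa.add analyticAt_const).congr hev

open Filter Topology in
lemma aux_inv_s14 (P : ℝ → ℝ) (u v : ℝ) (hP : AnalyticOnNhd ℝ P (Ioo u v))
    (hd : ∀ x ∈ Ioo u v, deriv P x < 0) :
    InjOn P (Ioo u v) ∧ StrictAntiOn P (Ioo u v) ∧
    ∃ X : ℝ → ℝ, (∀ x ∈ Ioo u v, X (P x) = x ∧ AnalyticAt ℝ X (P x) ∧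
      HasDerivAt X (deriv P x)⁻¹ (P x)) := by
  have hanti : StrictAntiOn P (Ioo u v) := by
    apply strictAntiOn_of_deriv_neg (convex_Ioo u v) hP.continuousOn
    rw [interior_Ioo]; exact hd
  refine ⟨hanti.injOn, hanti, Function.invFunOn P (Ioo u v), fun x hx => ?_⟩
  have hleft : ∀ y ∈ Ioo u v, Function.invFunOn P (Ioo u v) (P y) = y :=
    fun y hy => hanti.injOn.leftInvOn_invFunOn hy
  have hs : HasStrictDerivAt P (deriv P x) x := (hP x hx).hasStrictDerivAt
  have hev : ∀ᶠ y in 𝓝 x, Function.invFunOn P (Ioo u v) (P y) = y := by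
    filter_upwards [Ioo_mem_nhds hx.1 hx.2] with y hy using hleft y hy
  have hne := (hd x hx).ne
  refine ⟨hleft x hx, ?_, (hs.to_local_left_inverse hne hev).hasDerivAt⟩
  rw [← analyticAt_comp_iff_of_deriv_ne_zero (hP x hx) hne]
  exact analyticAt_id.congr (by filter_upwards [hev] with y hy; simp [hy])

open Polynomial Filter Topology in
lemma aux_P (x₀ : ℝ) (hx₀ : 0 < x₀) (G R : ℝ[X]) (hGR : G = C 2 + (X - C x₀) * R)
    (hpos : ∀ x ∈ Icc 0 x₀, 0 < G.eval x) :
    ∃ (u v : ℝ) (P : ℝ → ℝ), u < 0 ∧ x₀ < v ∧ AnalyticOnNhd ℝ P (Ioo u v) ∧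
      (∀ x ∈ Ioo u v, deriv P x < 0) ∧ P 0 = 1 ∧ P x₀ = 0 ∧
      (∀ x ∈ Ioo u v, (x - x₀) * G.eval x * deriv P x = 2 * P x) := by
  have hopen : IsOpen {x | 0 < G.eval x} := isOpen_lt continuous_const G.continuous
  have h0 : ∀ᶠ x in 𝓝 (0:ℝ), 0 < G.eval x := hopen.mem_nhds (hpos 0 ⟨le_rfl, hx₀.le⟩)
  have h1 : ∀ᶠ x in 𝓝 x₀, 0 < G.eval x := hopen.mem_nhds (hpos x₀ ⟨hx₀.le, le_rfl⟩)
  obtain ⟨e, he, hbe⟩ := Metric.eventually_nhds_iff_ball.1 h0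
  obtain ⟨d, hd, hbd⟩ := Metric.eventually_nhds_iff_ball.1 h1
  have hU : ∀ x ∈ Ioo (-e) (x₀ + d), 0 < G.eval x := by
    intro x hx
    rcases lt_or_ge x 0 with h | h
    · apply hbe; rw [Real.ball_eq_Ioo]; constructor <;> linarith [hx.1]
    · rcases le_or_gt x x₀ with h' | h'
      · exact hpos x ⟨h, h'⟩
      · apply hbd; rw [Real.ball_eq_Ioo]; constructor <;> linarith [hx.2]
  have h0U : (0:ℝ) ∈ Ioo (-e) (x₀ + d) := ⟨by linarith, by linarith⟩
  have hc : ContinuousOn (fun x => (-R).eval x / G.eval x) (Ioo (-e) (x₀ + d)) :=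
    (-R).continuous.continuousOn.div G.continuous.continuousOn (fun x hx => (hU x hx).ne')
  let L : ℝ → ℝ := fun x => ∫ t in (0:ℝ)..x, (-R).eval t / G.eval t
  have hL : ∀ x ∈ Ioo (-e) (x₀ + d), HasDerivAt L ((-R).eval x / G.eval x) x := by
    intro x hx
    have hsub : uIcc 0 x ⊆ Ioo (-e) (x₀ + d) := (ordConnected_Ioo).uIcc_subset h0U hx
    apply intervalIntegral.integral_hasDerivAt_right
    · exact (hc.mono hsub).intervalIntegrable
    · exact hc.stronglyMeasurableAtFilter isOpen_Ioo x hx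
    · exact hc.continuousAt (isOpen_Ioo.mem_nhds hx)
  have hLa : ∀ x ∈ Ioo (-e) (x₀ + d), AnalyticAt ℝ L x := fun x hx =>
    aux_prim_s14 (-R) G L x (hU x hx).ne' (by
      filter_upwards [isOpen_Ioo.mem_nhds hx] with y hy using hL y hy)
  have hPd : ∀ x ∈ Ioo (-e) (x₀ + d), HasDerivAt (fun x => (1 - x / x₀) * Real.exp (L x))
      (-(2 / (x₀ * G.eval x)) * Real.exp (L x)) x := by
    intro x hx
    have h5 := (((hasDerivAt_id x).div_const x₀).const_sub 1).mul (hL x hx).exp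
    convert! h5 using 1
    have hGx := (hU x hx).ne'
    have hG2 : G.eval x = 2 + (x - x₀) * R.eval x := by rw [hGR]; simp
    simp only [id, eval_neg]
    field_simp
    linear_combination hG2
  refine ⟨-e, x₀ + d, fun x => (1 - x / x₀) * Real.exp (L x), by linarith, by linarith,
    ?_, ?_, ?_, ?_, ?_⟩
  · intro x hx
    have := hLa x hx
    have h6 : AnalyticAt ℝ (fun x => 1 - x / x₀) x := by fun_prop (disch := exact hx₀.ne')
    exact h6.mul this.rexp
  · intro x hx
    rw [(hPd x hx).deriv]
    have := hU x hx
    have h7 : 0 < 2 / (x₀ * G.eval x) * Real.exp (L x) := by positivity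
    linarith
  · simp [L]
  · simp [hx₀.ne']
  · intro x hx
    rw [(hPd x hx).deriv]
    have := (hU x hx).ne'
    field_simp
    ring

open Polynomial in
lemma aux_factor (F : ℝ[X]) (x₀ : ℝ) (h0 : F.eval x₀ = 0) (h1 : F.derivative.eval x₀ = 2) :
    ∃ G R : ℝ[X], F = (X - C x₀) * G ∧ G = C 2 + (X - C x₀) * R := by
  obtain ⟨G, hG⟩ := dvd_iff_isRoot.2 (show F.IsRoot x₀ from h0)
  have hG2 : G.eval x₀ = 2 := by
    rw [hG] at h1
    simpa [derivative_mul] using h1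
  obtain ⟨R, hR⟩ := dvd_iff_isRoot.2 (show (G - C 2).IsRoot x₀ by simp [hG2])
  exact ⟨G, R, hG, by rw [← hR]; ring⟩

lemma aux_uniq (m : ℕ) (a c : ℝ) (f g : ℝ → ℝ)
    (hf : ∃ c' d' : ℝ, c' < -1 ∧ 1 < d' ∧ AnalyticOnNhd ℝ f (Ioo c' d'))
    (hg : ∃ c' d' : ℝ, c' < -1 ∧ 1 < d' ∧ AnalyticOnNhd ℝ g (Ioo c' d'))
    (hfe : ∀ r ∈ Icc (-1 : ℝ) 1, r * deriv f r = -c * f r ^ (m + 1) + a * f r - 1)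
    (hge : ∀ r ∈ Icc (-1 : ℝ) 1, r * deriv g r = -c * g r ^ (m + 1) + a * g r - 1)
    (h1 : f 1 = g 1) : EqOn f g (Icc (-1 : ℝ) 1) := by
  obtain ⟨c₁, d₁, hc₁, hd₁, hfa⟩ := hf
  obtain ⟨c₂, d₂, hc₂, hd₂, hga⟩ := hg
  have hsub₁ : Icc (-1:ℝ) 1 ⊆ Ioo c₁ d₁ := fun x hx => ⟨by linarith [hx.1], by linarith [hx.2]⟩
  have hsub₂ : Icc (-1:ℝ) 1 ⊆ Ioo c₂ d₂ := fun x hx => ⟨by linarith [hx.1], by linarith [hx.2]⟩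
  have hsub : Icc (1/2:ℝ) 1 ⊆ Icc (-1:ℝ) 1 := Icc_subset_Icc (by norm_num) le_rfl
  have hfc := (hfa.continuousOn.mono hsub₁).mono hsub
  have hgc := (hga.continuousOn.mono hsub₂).mono hsub
  -- bound
  obtain ⟨B₁, hB₁⟩ := isCompact_Icc.exists_bound_of_continuousOn hfc
  obtain ⟨B₂, hB₂⟩ := isCompact_Icc.exists_bound_of_continuousOn hgc
  let B := max B₁ B₂
  let F : ℝ → ℝ := fun x => -c * x ^ (m + 1) + a * x - 1
  have hFd : ContDiff ℝ 1 F := by fun_prop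
  obtain ⟨K, hK⟩ := hFd.contDiffOn.exists_lipschitzOnWith (s := Icc (-B) B) (by simp)
    (convex_Icc _ _) isCompact_Icc
  have hlip : ∀ t ∈ Ioc (1/2:ℝ) 1, LipschitzOnWith (2 * K) (fun x => F x / t) (Icc (-B) B) := by
    intro t ht
    have ht0 : 0 < t := by linarith [ht.1]
    apply LipschitzOnWith.of_dist_le_mul
    intro x hx y hy
    have h2 := hK.dist_le_mul x hx y hy
    rw [Real.dist_eq, ← sub_div, abs_div, abs_of_pos ht0, ← Real.dist_eq, div_le_iff₀ ht0]
    push_cast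
    have h3 : 0 ≤ (K:ℝ) * dist x y := by positivity
    nlinarith [ht.1]
  have key : ∀ (h : ℝ → ℝ), (∀ r ∈ Icc (-1:ℝ) 1, AnalyticAt ℝ h r) →
      (∀ r ∈ Icc (-1 : ℝ) 1, r * deriv h r = -c * h r ^ (m + 1) + a * h r - 1) →
      ∀ t ∈ Ioc (1/2:ℝ) 1, HasDerivWithinAt h (F (h t) / t) (Iic t) t := by
    intro h ha he t ht
    have ht' := hsub (Ioc_subset_Icc_self ht)
    have h5 := (ha t ht').differentiableAt.hasDerivAt
    have ht0 : t ≠ 0 := by linarith [ht.1]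
    have h6 : F (h t) / t = deriv h t := by
      rw [div_eq_iff ht0, mul_comm, he t ht']
    rw [h6]; exact h5.hasDerivWithinAt
  have heq : EqOn f g (Icc (1/2:ℝ) 1) := by
    apply ODE_solution_unique_of_mem_Icc_left (v := fun t x => F x / t) (s := fun _ => Icc (-B) B)
      hlip hfc (key f (fun r hr => hfa r (hsub₁ hr)) hfe) _ hgc
      (key g (fun r hr => hga r (hsub₂ hr)) hge) _ h1
    · intro t ht
      exact abs_le.1 ((hB₁ t (Ioc_subset_Icc_self ht)).trans (le_max_left _ _))
    · intro t ht
      exact abs_le.1 ((hB₂ t (Ioc_subset_Icc_self ht)).trans (le_max_right _ _))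
  have h34 : f =ᶠ[nhds (3/4:ℝ)] g := by
    filter_upwards [Icc_mem_nhds (show (1/2:ℝ) < 3/4 by norm_num) (show (3/4:ℝ) < 1 by norm_num)]
      with x hx using heq hx
  exact (hfa.mono hsub₁).eqOn_of_preconnected_of_eventuallyEq (hga.mono hsub₂) isPreconnected_Icc
    (show (3/4:ℝ) ∈ Icc (-1:ℝ) 1 by constructor <;> norm_num) h34

lemma aux_G (m : ℕ) (a k x₀ : ℝ) (hx₀ : 0 < x₀)
    (h0 : k * x₀ ^ (m + 1) + a * x₀ - 1 = 0) (h1 : k * (m + 1) * x₀ ^ m + a = 2)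
    (x : ℝ) (hx : 0 ≤ x) (hx' : x < x₀) : k * x ^ (m + 1) + a * x - 1 < 0 := by
  obtain ⟨t, rfl⟩ : ∃ t, x = t * x₀ := ⟨x / x₀, by field_simp⟩
  have ht0 : 0 ≤ t := nonneg_of_mul_nonneg_left hx hx₀
  have ht1 : t < 1 := by
    by_contra h
    push Not at h
    nlinarith
  obtain ⟨A, hA⟩ : ∃ A, A = k * x₀ ^ (m + 1) := ⟨_, rfl⟩
  have e1 : a * x₀ = 1 - A := by rw [hA]; linarith
  have e2 : 1 + m * A = 2 * x₀ := by
    have : m * A + A + a * x₀ = 2 * x₀ := by rw [hA, ← h1]; ring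
    linarith
  have e3 : k * (t * x₀) ^ (m + 1) + a * (t * x₀) - 1 = -(1 - t) - A * (t * (1 - t ^ m)) := by
    have : k * (t * x₀) ^ (m + 1) + a * (t * x₀) - 1
      = (k * x₀ ^ (m + 1)) * (t * t ^ m) + (a * x₀) * t - 1 := by ring
    rw [this, ← hA, e1]; ring
  rw [e3]
  have hp : t ^ m ≤ 1 := pow_le_one₀ ht0 ht1.le
  have hb : 1 + m * (t - 1) ≤ t ^ m := one_add_mul_sub_le_pow (by linarith) m
  have h5 : 0 ≤ t * (1 - t ^ m) := mul_nonneg ht0 (by linarith)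
  rcases le_or_gt 0 A with h | h
  · nlinarith [mul_nonneg h h5]
  · have h6 : t * (1 - t ^ m) ≤ m * (1 - t) := by nlinarith
    have h7 : -A * (t * (1 - t ^ m)) ≤ -A * (m * (1 - t)) :=
      mul_le_mul_of_nonneg_left h6 (by linarith)
    have h8 : 0 < (1 + m * A) * (1 - t) := mul_pos (by linarith) (by linarith)
    nlinarith

open Polynomial in
lemma aux_exist (m : ℕ) (a k x₀ : ℝ) (hx₀ : 0 < x₀)
    (h0 : k * x₀ ^ (m + 1) + a * x₀ - 1 = 0) (h1 : k * (m + 1) * x₀ ^ m + a = 2) :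
    ∃ (ξ : ℝ → ℝ) (d : ℝ), 1 < d ∧ AnalyticOnNhd ℝ ξ (Ioo (-d) d) ∧
      (∀ r ∈ Ioo (-d) d, r * deriv ξ r = k * ξ r ^ (m + 1) + a * ξ r - 1) ∧
      ξ 1 = 0 ∧ (∀ r, ξ (-r) = ξ r) ∧ (∀ r ∈ Ioo (-1 : ℝ) 1, 0 < ξ r) ∧
      (∀ r ∈ Ioc (0 : ℝ) 1, deriv ξ r < 0) := by
  obtain ⟨G, R, hFG, hGR⟩ := aux_factor (C k * X ^ (m + 1) + C a * X - C 1) x₀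
    (by simpa using h0) (by
      simp [derivative_X_pow]
      rw [← h1]; ring)
  have hev : ∀ x, k * x ^ (m + 1) + a * x - 1 = (x - x₀) * G.eval x := by
    intro x
    have := congrArg (Polynomial.eval x) hFG
    simpa using this
  have hG0 : G.eval x₀ = 2 := by rw [hGR]; simp
  have hpos : ∀ x ∈ Icc 0 x₀, 0 < G.eval x := by
    intro x hx
    rcases eq_or_lt_of_le hx.2 with h | h
    · rw [h, hG0]; norm_num
    · have := aux_G m a k x₀ hx₀ h0 h1 x hx.1 h
      rw [hev] at this
      exact pos_of_mul_neg_right this (by linarith)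
  obtain ⟨u, v, P, hu, hv, hPa, hPd, hP0, hPx, hPode⟩ := aux_P x₀ hx₀ G R hGR hpos
  obtain ⟨hinj, hanti, Y, hY⟩ := aux_inv_s14 P u v hPa hPd
  have hu2 : u / 2 ∈ Ioo u v := ⟨by linarith, by linarith⟩
  have hv2 : (x₀ + v) / 2 ∈ Ioo u v := ⟨by linarith, by linarith⟩
  have h0m : (0:ℝ) ∈ Ioo u v := ⟨hu, by linarith⟩
  have hxm : x₀ ∈ Ioo u v := ⟨by linarith, hv⟩
  have hPu : 1 < P (u / 2) := hP0 ▸ hanti hu2 h0m (by linarith)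
  have hPv : P ((x₀ + v) / 2) < 0 := hPx ▸ hanti hxm hv2 (by linarith)
  have hsurj : ∀ s, 0 ≤ s → s < P (u / 2) → ∃ x ∈ Ioo u v, P x = s := by
    intro s hs hs'
    have hsub : Icc (u / 2) ((x₀ + v) / 2) ⊆ Ioo u v :=
      fun y hy => ⟨by linarith [hy.1], by linarith [hy.2]⟩
    obtain ⟨x, hx, rfl⟩ := intermediate_value_Icc' (by linarith) (hPa.continuousOn.mono hsub)
      (show s ∈ Icc (P ((x₀ + v) / 2)) (P (u / 2)) from ⟨by linarith, hs'.le⟩)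
    exact ⟨x, hsub hx, rfl⟩
  have hsq : ∀ r ∈ Ioo (-√(P (u / 2))) (√(P (u / 2))), ∃ x ∈ Ioo u v, P x = r ^ 2 := by
    intro r hr
    exact hsurj _ (sq_nonneg r) (Real.sq_lt.2 hr)
  have hd1 : 1 < √(P (u / 2)) := by rw [Real.lt_sqrt (by norm_num)]; linarith
  have hder : ∀ r x, x ∈ Ioo u v → P x = r ^ 2 →
      HasDerivAt (fun r => Y (r ^ 2)) ((deriv P x)⁻¹ * (2 * r)) r := by
    intro r x hx hxr
    have h2 := (hY x hx).2.2
    rw [hxr] at h2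
    have h3 : HasDerivAt (fun r : ℝ => r ^ 2) (2 * r) r := by simpa using hasDerivAt_pow 2 r
    exact HasDerivAt.comp r h2 h3
  refine ⟨fun r => Y (r ^ 2), √(P (u / 2)), hd1, ?_, ?_, ?_, ?_, ?_, ?_⟩
  · intro r hr
    obtain ⟨x, hx, hxr⟩ := hsq r hr
    have h2 := (hY x hx).2.1
    rw [hxr] at h2
    exact AnalyticAt.fun_comp (g := Y) (f := fun r : ℝ => r ^ 2) h2 (by fun_prop)
  · intro r hr
    obtain ⟨x, hx, hxr⟩ := hsq r hr
    have h2 := (hY x hx).1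
    rw [(hder r x hx hxr).deriv]
    beta_reduce
    rw [← hxr, h2, hev]
    have h4 := hPode x hx
    have h5 := (hPd x hx).ne
    have : r * ((deriv P x)⁻¹ * (2 * r)) = 2 * P x * (deriv P x)⁻¹ := by rw [hxr]; ring
    rw [this, ← h4]
    field_simp
  · have := (hY 0 h0m).1
    rw [hP0] at this
    simpa using this
  · intro r; simp
  · intro r hr
    obtain ⟨x, hx, hxr⟩ := hsq r ⟨by linarith [hr.1], by linarith [hr.2]⟩
    beta_reduce
    rw [← hxr, (hY x hx).1]
    by_contra hneg
    push Not at hneg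
    have h6 : P 0 ≤ P x := hanti.antitoneOn hx h0m hneg
    rw [hP0, hxr] at h6
    nlinarith [hr.1, hr.2]
  · intro r hr
    obtain ⟨x, hx, hxr⟩ := hsq r ⟨by linarith [hr.1], by linarith [hr.2]⟩
    rw [(hder r x hx hxr).deriv]
    exact mul_neg_of_neg_of_pos (inv_lt_zero.2 (hPd x hx)) (by linarith [hr.1])

lemma aux_phi (m : ℕ) (a k α : ℝ) (hα : α * (m + 1) = 2 + a * m) (ξ φ : ℝ → ℝ)
    (hdiff : ∀ r ∈ Ioo (0 : ℝ) 1, DifferentiableAt ℝ ξ r)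
    (hode : ∀ r ∈ Ioo (0 : ℝ) 1, r * deriv ξ r = k * ξ r ^ (m + 1) + a * ξ r - 1)
    (hneg : ∀ r ∈ Ioo (0 : ℝ) 1, deriv ξ r < 0)
    (hφ : ∀ r : ℝ, φ r = 2 * (r / (-(deriv ξ r))) ^ (1 / ((m : ℝ) + 1)) * ξ r)
    (r : ℝ) (hr : r ∈ Ioo (0 : ℝ) 1) :
    r * ξ r * deriv φ r + (1 - α * ξ r) * φ r = 0 := by
  have hm1 : (m : ℝ) + 1 ≠ 0 := by positivity
  have hr0 : r ≠ 0 := hr.1.ne'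
  let W : ℝ → ℝ := fun ρ => ρ ^ 2 / (-(k * ξ ρ ^ (m + 1) + a * ξ ρ - 1))
  have hW : ∀ ρ ∈ Ioo (0 : ℝ) 1, ρ / (-(deriv ξ ρ)) = W ρ := by
    intro ρ hρ
    have h1 := (hneg ρ hρ).ne
    have h2 := hρ.1.ne'
    simp only [W]
    rw [← hode ρ hρ]
    field_simp
  have hev : φ =ᶠ[nhds r] fun ρ => 2 * (W ρ) ^ (1 / ((m : ℝ) + 1)) * ξ ρ := by
    filter_upwards [isOpen_Ioo.mem_nhds hr] with ρ hρ
    rw [hφ, hW ρ hρ]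
  obtain ⟨D, hD⟩ : ∃ D, D = deriv ξ r := ⟨_, rfl⟩
  have hDneg : D < 0 := hD ▸ hneg r hr
  have hoder := hode r hr
  rw [← hD] at hoder
  have hξ : HasDerivAt ξ D r := hD ▸ (hdiff r hr).hasDerivAt
  have hWpos : 0 < W r := by
    rw [← hW r hr, ← hD]; exact div_pos hr.1 (by linarith)
  have hWr : W r = r / (-D) := by rw [← hW r hr, ← hD]
  have hN : HasDerivAt (fun ρ => -(k * ξ ρ ^ (m + 1) + a * ξ ρ - 1))
      (-((k * (m + 1) * ξ r ^ m + a) * D)) r := by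
    have := ((((hξ.pow (m + 1)).const_mul k).add (hξ.const_mul a)).sub_const 1).neg
    convert! this using 1
    push_cast
    simp
    ring
  have hne : -(k * ξ r ^ (m + 1) + a * ξ r - 1) ≠ 0 := by
    rw [← hoder]
    exact neg_ne_zero.2 (mul_ne_zero hr0 hDneg.ne)
  have hsq : HasDerivAt (fun r : ℝ => r ^ 2) (2 * r) r := by simpa using hasDerivAt_pow 2 r
  have hWd : HasDerivAt W (W r * (2 - (k * (m + 1) * ξ r ^ m + a)) / r) r := by
    have := hsq.div hN hne
    convert! this using 1
    rw [hWr, ← hoder]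
    field_simp
    ring
  have hp := hWd.rpow_const (p := 1 / ((m : ℝ) + 1)) (Or.inl hWpos.ne')
  have hφd := (((hp.const_mul 2).mul hξ).congr_of_eventuallyEq hev).deriv
  rw [hφd, hφ, hW r hr]
  rw [Real.rpow_sub_one hWpos.ne']
  obtain ⟨Z, hZ⟩ : ∃ Z, Z = W r ^ (1 / ((m : ℝ) + 1)) := ⟨_, rfl⟩
  rw [← hZ]
  have hα' : α = (2 + a * m) / (m + 1) := by rw [← hα]; field_simp
  have hWn := hWpos.ne'
  rw [hα']
  have hDe : D = (k * ξ r ^ (m + 1) + a * ξ r - 1) / r := by rw [← hoder]; field_simp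
  rw [hDe]
  field_simp
  ring

/-- Proposition 4.8 of the paper: existence and uniqueness of the
real analytic solution ξ on [−1,1] of r·ξ' = −c·ξ^{m+1} + a·ξ − 1, ξ(1) = 0,
together with evenness, positivity on (−1,1), ξ' < 0 on (0,1], and the ODE for
φ(r) = 2·(r/(−ξ'))^{1/(m+1)}·ξ on (0,1). -/
theorem stmt_14 (m : ℕ) (hm : 2 ≤ m) (lam : ℝ) (hlam : lam < 0)
    (a α c : ℝ)
    (hA : a = -2 * lam / m)
    (hα : α = 2 * (1 - lam) / ((m : ℝ) + 1))
    (hc : c = -((2 / ((m : ℝ) + 1)) ^ (m + 1) * (1 - lam) ^ m * (1 + lam / m))) :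
    ∃ ξ : ℝ → ℝ,
      (∃ c' d' : ℝ, c' < -1 ∧ 1 < d' ∧ AnalyticOnNhd ℝ ξ (Ioo c' d')) ∧
      (∀ r ∈ Icc (-1 : ℝ) 1,
        r * deriv ξ r = -c * ξ r ^ (m + 1) + a * ξ r - 1) ∧
      ξ 1 = 0 ∧
      (∀ ξ' : ℝ → ℝ,
        (∃ c' d' : ℝ, c' < -1 ∧ 1 < d' ∧ AnalyticOnNhd ℝ ξ' (Ioo c' d')) →
        (∀ r ∈ Icc (-1 : ℝ) 1,
          r * deriv ξ' r = -c * ξ' r ^ (m + 1) + a * ξ' r - 1) →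
        ξ' 1 = 0 →
        EqOn ξ ξ' (Icc (-1 : ℝ) 1)) ∧
      (∀ r ∈ Icc (-1 : ℝ) 1, ξ (-r) = ξ r) ∧
      (∀ r ∈ Ioo (-1 : ℝ) 1, 0 < ξ r) ∧
      (∀ r ∈ Ioc (0 : ℝ) 1, deriv ξ r < 0) ∧
      (∀ φ : ℝ → ℝ,
        (∀ r : ℝ, φ r = 2 * (r / (-(deriv ξ r))) ^ (1 / ((m : ℝ) + 1)) * ξ r) →
        ∀ r ∈ Ioo (0 : ℝ) 1,
          r * ξ r * deriv φ r + (1 - α * ξ r) * φ r = 0) := by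
  have hmpos : (0:ℝ) < m := by exact_mod_cast (by omega : 0 < m)
  have hm1 : (0:ℝ) < (m:ℝ) + 1 := by positivity
  have hl : 0 < 1 - lam := by linarith
  obtain ⟨x₀, hx⟩ : ∃ x₀ : ℝ, x₀ = ((m:ℝ) + 1) / (2 * (1 - lam)) := ⟨_, rfl⟩
  have hx₀ : 0 < x₀ := by rw [hx]; positivity
  have hcx : -c * x₀ ^ m = 2 / ((m:ℝ) + 1) * (1 + lam / m) := by
    have h1 : (2 / ((m:ℝ) + 1)) * (1 - lam) * x₀ = 1 := by rw [hx]; field_simp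
    have h2 : -c * x₀ ^ m = (2 / ((m:ℝ) + 1) * (1 - lam) * x₀) ^ m *
        (2 / ((m:ℝ) + 1) * (1 + lam / m)) := by
      rw [hc, mul_pow, mul_pow, pow_succ]; ring
    rw [h2, h1]; simp
  have h0 : -c * x₀ ^ (m + 1) + a * x₀ - 1 = 0 := by
    rw [pow_succ, ← mul_assoc, hcx, hA, hx]
    field_simp
    ring
  have h1 : -c * (m + 1) * x₀ ^ m + a = 2 := by
    have : -c * (m + 1) * x₀ ^ m + a = (-c * x₀ ^ m) * (m + 1) + a := by ring
    rw [this, hcx, hA]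
    field_simp
    ring
  obtain ⟨ξ, d, hd, han, hode, hξ1, heven, hpos, hneg⟩ := aux_exist m a (-c) x₀ hx₀ h0 h1
  have hsub : Icc (-1:ℝ) 1 ⊆ Ioo (-d) d := fun x hx => ⟨by linarith [hx.1], by linarith [hx.2]⟩
  have hsub' : Ioo (0:ℝ) 1 ⊆ Icc (-1:ℝ) 1 := fun x hx => ⟨by linarith [hx.1], hx.2.le⟩
  have hA1 : ∃ c' d' : ℝ, c' < -1 ∧ 1 < d' ∧ AnalyticOnNhd ℝ ξ (Ioo c' d') :=
    ⟨-d, d, by linarith, hd, han⟩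
  refine ⟨ξ, hA1, fun r hr => hode r (hsub hr), hξ1, ?_, fun r _ => heven r, hpos, hneg, ?_⟩
  · intro η hη hηode hη1
    exact aux_uniq m a c ξ η hA1 hη (fun r hr => hode r (hsub hr)) hηode (by rw [hξ1, hη1])
  · intro φ hφ r hr
    refine aux_phi m a (-c) α ?_ ξ φ (fun r hr => (han r (hsub (hsub' hr))).differentiableAt)
      (fun r hr => hode r (hsub (hsub' hr))) (fun r hr => hneg r ⟨hr.1, hr.2.le⟩) hφ r hr
    rw [hα, hA]
    field_simp
    ring
end

section
/- Let ξ be the unique real analytic function on [−1,1] satisfying r·ξ'(r) = −c·ξ(r)^{m+1} + a·ξ(r) − 1 on [−1,1] and ξ(1) = 0 (it exists, is even, positive on (−1,1), and has ξ' < 0 on (0,1]), and let φ(r) = 2·(r/(−ξ'(r)))^{1/(m+1)}·ξ(r) for r ∈ (0,1). Then the following are equivalent: (1) ξ is rational, i.e., there exist real polynomials p and q with q nowhere zero on [−1,1] such that ξ(r) = p(r)/q(r) for all r ∈ [−1,1]; (2) φ^{m+1} is rational, i.e., there exist real polynomials p and q with q nowhere zero on (0,1) such that φ(r)^{m+1}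 = p(r)/q(r) for all r ∈ (0,1); (3) λ = −m. -/
open Polynomial Set

lemma aux_key (m : ℕ) (hm : 2 ≤ m) (a c : ℝ) (ξ : ℝ → ℝ)
    (hODE : ∀ r ∈ Ioo (0 : ℝ) 1,
      r * deriv ξ r = -c * ξ r ^ (m + 1) + a * ξ r - 1)
    (hξ' : ∀ r ∈ Ioo (0 : ℝ) 1, deriv ξ r < 0)
    (p q : ℝ[X]) (hq : ∀ r ∈ Ioo (0 : ℝ) 1, q.eval r ≠ 0)
    (h : ∀ r ∈ Ioo (0 : ℝ) 1, ξ r = p.eval r / q.eval r) : c = 0 := by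
  by_contra hc
  -- reduce to coprime p, q
  obtain ⟨p₁, q₁, hcop, hq₁, h₁⟩ : ∃ p₁ q₁ : ℝ[X], IsCoprime p₁ q₁ ∧
      (∀ r ∈ Ioo (0 : ℝ) 1, q₁.eval r ≠ 0) ∧
      (∀ r ∈ Ioo (0 : ℝ) 1, ξ r = p₁.eval r / q₁.eval r) := by
    have hq0 : q ≠ 0 := by
      rintro rfl
      exact hq (1/2) (by norm_num) (by simp)
    have hp := EuclideanDomain.mul_div_cancel' (a := p) (b := GCDMonoid.gcd p q)
      (gcd_ne_zero_of_right hq0) (GCDMonoid.gcd_dvd_left p q)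
    have hqq := EuclideanDomain.mul_div_cancel' (a := q) (b := GCDMonoid.gcd p q)
      (gcd_ne_zero_of_right hq0) (GCDMonoid.gcd_dvd_right p q)
    have hcop := isCoprime_div_gcd_div_gcd (p := p) hq0
    generalize GCDMonoid.gcd p q = g at *
    generalize p / g = p₁ at *
    generalize q / g = q₁ at *
    subst hp hqq
    refine ⟨p₁, q₁, hcop, ?_, ?_⟩
    · intro r hr h0
      apply hq r hr
      rw [eval_mul, h0, mul_zero]
    · intro r hr
      have hne := hq r hr
      rw [h r hr]
      rw [eval_mul] at hne
      rw [eval_mul, eval_mul, mul_div_mul_left _ _ (left_ne_zero_of_mul hne)]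
  have hder : ∀ r ∈ Ioo (0 : ℝ) 1, deriv ξ r =
      (p₁.derivative.eval r * q₁.eval r - p₁.eval r * q₁.derivative.eval r) / q₁.eval r ^ 2 := by
    intro r hr
    have he : ξ =ᶠ[nhds r] fun x => p₁.eval x / q₁.eval x := by
      filter_upwards [isOpen_Ioo.mem_nhds hr] with x hx using h₁ x hx
    rw [he.deriv_eq]
    exact ((p₁.hasDerivAt r).div (q₁.hasDerivAt r) (hq₁ r hr)).deriv
  obtain ⟨k, rfl⟩ : ∃ k, m = k + 2 := ⟨m - 2, by omega⟩
  have hinf : (Ioo (0 : ℝ) 1).Infinite := Ioo_infinite (by norm_num)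
  have hpoly : X * (derivative p₁ * q₁ - p₁ * derivative q₁) * q₁ ^ (k + 1) =
      C (-c) * p₁ ^ (k + 3) + C a * p₁ * q₁ ^ (k + 2) - q₁ ^ (k + 3) := by
    apply eq_of_infinite_eval_eq
    refine hinf.mono fun r hr => ?_
    have ho := hODE r hr
    have hne := hq₁ r hr
    rw [hder r hr, h₁ r hr] at ho
    simp only [mem_ofPred_eq, eval_mul, eval_sub, eval_add, eval_pow, eval_X, eval_C]
    set P := p₁.eval r
    set Q := q₁.eval r
    rw [div_pow] at ho
    field_simp at ho
    apply mul_left_cancel₀ (pow_ne_zero 2 hne)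
    linear_combination ho
  have hdvd : q₁ ∣ p₁ ^ (k + 3) := by
    have h1 : q₁ ∣ C (-c) * p₁ ^ (k + 3) := by
      refine ⟨X * (derivative p₁ * q₁ - p₁ * derivative q₁) * q₁ ^ k - C a * p₁ * q₁ ^ (k + 1)
        + q₁ ^ (k + 2), ?_⟩
      linear_combination -hpoly
    have hu : IsUnit (C (-c)) := isUnit_C.2 (by simpa using hc)
    exact (hu.dvd_mul_left).1 h1
  have hunit : IsUnit q₁ := (hcop.pow_left (m := k + 3)).symm.isUnit_of_dvd' dvd_rfl hdvd
  obtain ⟨b, hb, rfl⟩ := Polynomial.isUnit_iff.1 hunit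
  have hb0 : b ≠ 0 := hb.ne_zero
  have hdeg : p₁.natDegree = 0 := by
    by_contra hd
    have h3 : C (-c) * p₁ ^ (k + 3) = C (b ^ (k + 2)) * (X * derivative p₁)
      - C (a * b ^ (k + 2)) * p₁ + C (b ^ (k + 3)) := by
      simp only [derivative_C, C_mul, C_pow] at hpoly ⊢
      linear_combination -hpoly
    have h4 : (C (-c) * p₁ ^ (k + 3)).natDegree = (k + 3) * p₁.natDegree := by
      rw [natDegree_C_mul (by simpa using hc), natDegree_pow]
    have h5 : (C (b ^ (k + 2)) * (X * derivative p₁)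
      - C (a * b ^ (k + 2)) * p₁ + C (b ^ (k + 3))).natDegree ≤ p₁.natDegree := by
      refine natDegree_add_le_of_degree_le ((natDegree_sub_le_of_le (m := p₁.natDegree) ?_ (natDegree_C_mul_le _ _)).trans (by simp)) (by simp)
      refine (natDegree_C_mul_le _ _).trans (natDegree_mul_le.trans ?_)
      have := natDegree_derivative_le p₁
      rw [natDegree_X]; omega
    rw [← h3, h4] at h5
    nlinarith [Nat.pos_of_ne_zero hd]
  have hx := hder (1/2) (by norm_num)
  have hlt := hξ' (1/2) (by norm_num)
  rw [eq_C_of_natDegree_eq_zero hdeg] at hx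
  simp at hx
  norm_num at hlt hx
  linarith

lemma aux_phi_s16 (m : ℕ) (a c : ℝ) (ξ : ℝ → ℝ)
    (hd : ∀ r ∈ Ioo (0 : ℝ) 1, DifferentiableAt ℝ ξ r)
    (hODE : ∀ r ∈ Ioo (0 : ℝ) 1,
      r * deriv ξ r = -c * ξ r ^ (m + 1) + a * ξ r - 1)
    (hpos : ∀ r ∈ Ioo (0 : ℝ) 1, 0 < ξ r)
    (hξ' : ∀ r ∈ Ioo (0 : ℝ) 1, deriv ξ r < 0)
    (p q : ℝ[X]) (hq : ∀ r ∈ Ioo (0 : ℝ) 1, q.eval r ≠ 0)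
    (h : ∀ r ∈ Ioo (0 : ℝ) 1,
      2 ^ (m + 1) * (r / (-(deriv ξ r))) * ξ r ^ (m + 1) = p.eval r / q.eval r) :
    ∃ p q : ℝ[X], (∀ r ∈ Ioo (0 : ℝ) 1, q.eval r ≠ 0) ∧
      (∀ r ∈ Ioo (0 : ℝ) 1, ξ r = p.eval r / q.eval r) := by
  set Q : ℝ[X] := C (2 ^ (m + 1)) * q * X ^ 2 with hQ
  have hQ0 : ∀ r ∈ Ioo (0 : ℝ) 1, Q.eval r ≠ 0 := by
    intro r hr
    simp [hQ, hq r hr, hr.1.ne']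
  have hp0 : ∀ r ∈ Ioo (0 : ℝ) 1, p.eval r ≠ 0 := by
    intro r hr h0
    have h1 := h r hr
    rw [h0, zero_div] at h1
    have : 0 < 2 ^ (m + 1) * (r / (-(deriv ξ r))) * ξ r ^ (m + 1) := by
      have := hpos r hr
      have := hr.1
      have : 0 < -(deriv ξ r) := by linarith [hξ' r hr]
      positivity
    linarith
  have hrel : ∀ r ∈ Ioo (0 : ℝ) 1, p.eval r * (c * ξ r ^ (m + 1) - a * ξ r + 1) =
      Q.eval r * ξ r ^ (m + 1) := by
    intro r hr
    have h1 := h r hr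
    have h2 := (hξ' r hr).ne
    have h3 := hq r hr
    have h4 := hODE r hr
    have h5 : c * ξ r ^ (m + 1) - a * ξ r + 1 = - (r * deriv ξ r) := by linarith
    rw [h5]
    simp only [hQ, eval_mul, eval_C, eval_pow, eval_X]
    field_simp at h1
    linear_combination r * h1
  have hmain : ∀ r ∈ Ioo (0 : ℝ) 1,
      ξ r * (r * Q.derivative.eval r * p.eval r - r * p.derivative.eval r * Q.eval r
        + m * a * p.eval r * Q.eval r) = (m + 1) * p.eval r * Q.eval r := by
    intro r hr
    have hx := (hd r hr).hasDerivAt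
    have hL := (p.hasDerivAt r).mul ((((hx.pow (m + 1)).const_mul c).sub (hx.const_mul a)).add_const 1)
    have hR := (Q.hasDerivAt r).mul (hx.pow (m + 1))
    have hL' := hL.congr_of_eventuallyEq (f₁ := fun x => Q.eval x * ξ x ^ (m + 1)) (by
      filter_upwards [isOpen_Ioo.mem_nhds hr] with x hx
      simpa using (hrel x hx).symm)
    have he := hL'.unique hR
    simp at he
    have hre := hrel r hr
    have ho := hODE r hr
    have hxp := (hpos r hr).ne'
    have hP : c * ξ r ^ (m + 1) - a * ξ r + 1 ≠ 0 := by
      have h5 : c * ξ r ^ (m + 1) - a * ξ r + 1 = - (r * deriv ξ r) := by linarith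
      rw [h5]
      exact neg_ne_zero.2 (mul_ne_zero hr.1.ne' (hξ' r hr).ne)
    apply mul_left_cancel₀ hP
    generalize deriv ξ r = d at *
    generalize ξ r = x at *
    generalize eval r p = P at *
    generalize eval r Q = S at *
    generalize eval r (derivative p) = P' at *
    generalize eval r (derivative Q) = S' at *
    have hyx : x ^ (m + 1) = x ^ m * x := pow_succ x m
    rw [hyx] at he hre ho ⊢
    generalize x ^ m = y at *
    linear_combination (-(x * S) * r) * he + (x * S * (P * (c * (m + 1) * y - a) - S * (m + 1) * y)) * ho
      + (r * S' * x - S * (m + 1) * (c * (y * x) - a * x + 1)) * hre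
  refine ⟨C ((m : ℝ) + 1) * p * Q, X * derivative Q * p - X * derivative p * Q
    + C (m * a) * p * Q, ?_, ?_⟩
  · intro r hr h0
    have h1 := hmain r hr
    simp only [eval_mul, eval_sub, eval_add, eval_X, eval_C] at h0
    rw [h0, mul_zero] at h1
    have : (m : ℝ) + 1 ≠ 0 := by positivity
    exact mul_ne_zero (mul_ne_zero this (hp0 r hr)) (hQ0 r hr) h1.symm
  · intro r hr
    have h1 := hmain r hr
    have : (m : ℝ) + 1 ≠ 0 := by positivity
    have h2 := mul_ne_zero (mul_ne_zero this (hp0 r hr)) (hQ0 r hr)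
    rw [← h1] at h2
    simp only [eval_mul, eval_sub, eval_add, eval_X, eval_C]
    rw [eq_div_iff (right_ne_zero_of_mul h2)]
    exact h1

lemma aux_sol (ξ : ℝ → ℝ)
    (hd : ∀ r ∈ Icc (0 : ℝ) 1, DifferentiableAt ℝ ξ r)
    (hODE : ∀ r ∈ Icc (-1 : ℝ) 1, r * deriv ξ r = 2 * ξ r - 1)
    (hξ1 : ξ 1 = 0) : ∀ r ∈ Icc (0 : ℝ) 1, ξ r = (1 - r ^ 2) / 2 := by
  intro r hr
  rcases hr.1.eq_or_lt with rfl | h0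
  · have := hODE 0 (by norm_num)
    linarith
  have hder : ∀ x ∈ Icc r 1, HasDerivAt (fun x => (2 * ξ x - 1) / x ^ 2) 0 x := by
    intro x hx
    have hx0 : 0 < x := h0.trans_le hx.1
    have h1 := (hd x ⟨hx0.le, hx.2⟩).hasDerivAt
    have h2 := ((h1.const_mul 2).sub_const 1).div (hasDerivAt_pow 2 x) (by positivity)
    refine h2.congr_deriv ?_
    have h3 := hODE x ⟨by linarith, hx.2⟩
    rw [← h3]
    push_cast
    field_simp
    ring
  have := constant_of_has_deriv_right_zero (a := r) (b := 1)
    (fun x hx => (hder x hx).continuousAt.continuousWithinAt)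
    (fun x hx => (hder x ⟨hx.1, hx.2.le⟩).hasDerivWithinAt) 1 ⟨hr.2, le_rfl⟩
  simp only [hξ1] at this
  field_simp at this
  linarith

/-- Proposition 4.10 of the paper: for the solution ξ of the egg
domain ODE, rationality of ξ, rationality of φ^{m+1}, and λ = −m are
equivalent. -/
theorem stmt_16 (m : ℕ) (hm : 2 ≤ m) (lam : ℝ) (hlam : lam < 0)
    (a α c : ℝ)
    (hA : a = -2 * lam / m)
    (hα : α = 2 * (1 - lam) / ((m : ℝ) + 1))
    (hc : c = -((2 / ((m : ℝ) + 1)) ^ (m + 1) * (1 - lam) ^ m * (1 + lam / m)))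
    (ξ : ℝ → ℝ)
    (hξan : ∃ c' d' : ℝ, c' < -1 ∧ 1 < d' ∧ AnalyticOnNhd ℝ ξ (Ioo c' d'))
    (hODE : ∀ r ∈ Icc (-1 : ℝ) 1,
      r * deriv ξ r = -c * ξ r ^ (m + 1) + a * ξ r - 1)
    (hξ1 : ξ 1 = 0)
    (hξeven : ∀ r ∈ Icc (-1 : ℝ) 1, ξ (-r) = ξ r)
    (hξpos : ∀ r ∈ Ioo (-1 : ℝ) 1, 0 < ξ r)
    (hξ' : ∀ r ∈ Ioc (0 : ℝ) 1, deriv ξ r < 0)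
    (φ : ℝ → ℝ)
    (hφ : ∀ r : ℝ, φ r = 2 * (r / (-(deriv ξ r))) ^ (1 / ((m : ℝ) + 1)) * ξ r) :
    ((∃ p q : Polynomial ℝ,
        (∀ r ∈ Icc (-1 : ℝ) 1, q.eval r ≠ 0) ∧
        (∀ r ∈ Icc (-1 : ℝ) 1, ξ r = p.eval r / q.eval r)) ↔ lam = -(m : ℝ)) ∧
    ((∃ p q : Polynomial ℝ,
        (∀ r ∈ Ioo (0 : ℝ) 1, q.eval r ≠ 0) ∧
        (∀ r ∈ Ioo (0 : ℝ) 1, φ r ^ (m + 1) = p.eval r / q.eval r)) ↔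
      lam = -(m : ℝ)) := by
  have hm0 : (m : ℝ) ≠ 0 := by
    have : m ≠ 0 := by omega
    exact_mod_cast this
  have hd : ∀ r ∈ Icc (-1 : ℝ) 1, DifferentiableAt ℝ ξ r := by
    obtain ⟨c', d', h1, h2, h3⟩ := hξan
    intro r hr
    exact (h3 r ⟨by linarith [hr.1], by linarith [hr.2]⟩).differentiableAt
  have hsub : ∀ r ∈ Ioo (0 : ℝ) 1, r ∈ Icc (-1 : ℝ) 1 :=
    fun r hr => ⟨by linarith [hr.1], hr.2.le⟩
  have hODE' := fun r hr => hODE r (hsub r hr)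
  have hneg : ∀ r ∈ Ioo (0 : ℝ) 1, deriv ξ r < 0 := fun r hr => hξ' r ⟨hr.1, hr.2.le⟩
  have hpos : ∀ r ∈ Ioo (0 : ℝ) 1, 0 < ξ r :=
    fun r hr => hξpos r ⟨by linarith [hr.1], hr.2⟩
  have hc0 : c = 0 → lam = -(m : ℝ) := by
    intro h
    rw [hc, neg_eq_zero] at h
    have h1 : (2 / ((m : ℝ) + 1)) ^ (m + 1) * (1 - lam) ^ m ≠ 0 := by
      have : 0 < 1 - lam := by linarith
      positivity
    have h2 := (mul_eq_zero.1 h).resolve_left h1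
    field_simp at h2
    linarith
  have hsol : lam = -(m : ℝ) → ∀ r ∈ Icc (0 : ℝ) 1, ξ r = (1 - r ^ 2) / 2 := by
    intro hl
    have hc1 : c = 0 := by
      rw [hc, hl]; field_simp; simp
    have ha1 : a = 2 := by
      rw [hA, hl]; field_simp
    refine aux_sol ξ (fun r hr => hd r ⟨by linarith [hr.1], hr.2⟩) ?_ hξ1
    intro r hr
    rw [hODE r hr, hc1, ha1]; ring
  have hphi : ∀ r ∈ Ioo (0 : ℝ) 1,
      φ r ^ (m + 1) = 2 ^ (m + 1) * (r / (-(deriv ξ r))) * ξ r ^ (m + 1) := by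
    intro r hr
    have h1 : 0 ≤ r / (-(deriv ξ r)) :=
      div_nonneg hr.1.le (by linarith [hneg r hr])
    rw [hφ, mul_pow, mul_pow, ← Real.rpow_natCast (_ ^ (1 / ((m : ℝ) + 1))), ← Real.rpow_mul h1]
    have : (1 / ((m : ℝ) + 1)) * ((m + 1 : ℕ) : ℝ) = 1 := by
      push_cast
      have : (m : ℝ) + 1 ≠ 0 := by positivity
      field_simp
    rw [this, Real.rpow_one]
  refine ⟨⟨?_, ?_⟩, ⟨?_, ?_⟩⟩
  · rintro ⟨p, q, hq, h⟩
    exact hc0 (aux_key m hm a c ξ hODE' hneg p q (fun r hr => hq r (hsub r hr))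
      (fun r hr => h r (hsub r hr)))
  · intro hl
    refine ⟨C (1/2) * (1 - X ^ 2), 1, by simp, ?_⟩
    intro r hr
    have : ξ r = (1 - r ^ 2) / 2 := by
      rcases le_total 0 r with h0 | h0
      · exact hsol hl r ⟨h0, hr.2⟩
      · rw [← hξeven r hr, hsol hl (-r) ⟨by linarith, by linarith [hr.1]⟩]
        ring
    rw [this]
    simp
    ring
  · rintro ⟨p, q, hq, h⟩
    obtain ⟨p', q', hq', h'⟩ := aux_phi_s16 m a c ξ (fun r hr => hd r (hsub r hr)) hODE' hpos hneg p q hq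
      (fun r hr => by rw [← hphi r hr, h r hr])
    exact hc0 (aux_key m hm a c ξ hODE' hneg p' q' hq' h')
  · intro hl
    refine ⟨(1 - X ^ 2) ^ (m + 1), 1, by simp, ?_⟩
    intro r hr
    have hs := hsol hl r ⟨hr.1.le, hr.2.le⟩
    have hc1 : c = 0 := by
      rw [hc, hl]; field_simp; simp
    have ha1 : a = 2 := by
      rw [hA, hl]; field_simp
    have ho := hODE' r hr
    have hdr : deriv ξ r = -r := by
      apply mul_left_cancel₀ hr.1.ne'
      rw [ho, hs, hc1, ha1]; ring
    rw [hphi r hr, hdr, hs, neg_neg, div_self hr.1.ne', mul_one, ← mul_pow]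
    simp
    congr 1
    ring
end
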